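/- arXiv:1411.6089 — 2 statements merged into one kernel-verified Lean document; each statement's English description precedes it below -/
import Mathlib

section
/- Let F be a field of characteristic 2. The essential dimension of the split algebraic group G₂ over F (i.e., of the functor K ↦ G₂-torsors over K, equivalently K ↦ isomorphism classes of octonion K-algebras) equals 3: ed(G₂) = 3. -/
/-!
Statement 5: Let `F` be a field of characteristic `2`.  The essential dimension of the split
algebraic group `G₂` over `F` equals `3`.

`G₂`-torsors over a field extension `K/F` are in natural bijection with the `K`-isomorphism
classes of octonion `K`-algebras, equivalently with the `K`-isomorphism classes of `3`-fold
quadratic Pfister forms `⟨⟨a₁, a₂, a₃]] = ⟨1,a₁⟩ ⊗ ⟨1,a₂⟩ ⊗ [1,a₃]` (the norm forms of octonion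
algebras).  Hence `ed(G₂)` is the essential dimension of the functor
`K ↦ {isomorphism classes of 3-fold quadratic Pfister forms over K}`.  A class over `K` is
defined over an intermediate field `E` precisely when it is represented by a `3`-fold quadratic
Pfister form with coefficients in `E`.
-/

universe u

noncomputable section

/-- The Gram matrix of the `(m+1)`-fold quadratic Pfister form
`⟨⟨a₁, …, a_m, b]] = ⟨1,a₁⟩ ⊗ ⋯ ⊗ ⟨1,a_m⟩ ⊗ [1,b]` in its natural basis: it is the orthogonal
sum, over the subsets `S ⊆ {1,…,m}` (encoded as `S : Fin m → Bool`), of the binary forms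
`c_S · [1, b]` with `c_S = ∏_{i ∈ S} a_i`, where `[1,b]` is the binary quadratic form
`(x, y) ↦ x² + xy + by²`. -/
def pfisterMatrix {K : Type*} [Field K] {m : ℕ} (a : Fin m → K) (b : K) :
    Matrix ((Fin m → Bool) × Bool) ((Fin m → Bool) × Bool) K :=
  fun r c =>
    if r.1 = c.1 then
      (∏ i, if r.1 i then a i else 1) *
        (if r.2 then (if c.2 then b else 0) else 1)
    else 0

/-- The `(m+1)`-fold quadratic Pfister form
`⟨⟨a₁, …, a_m, b]] = ⟨1,a₁⟩ ⊗ ⋯ ⊗ ⟨1,a_m⟩ ⊗ [1,b]`, as a quadratic form in `2^(m+1)`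
variables given by `v ↦ vᵀ M v` for its Gram matrix `M`. -/
def quadPfister {K : Type*} [Field K] {m : ℕ} (a : Fin m → K) (b : K) :
    QuadraticForm K (((Fin m → Bool) × Bool) → K) :=
  (pfisterMatrix a b).toQuadraticMap'

/-- `trdeg_F E ≤ n`: there are at most `n` elements of `E` over which `E` is algebraic. -/
def TrdegLE (F E : Type*) [Field F] [Field E] [Algebra F E] (n : ℕ) : Prop :=
  ∃ s : Finset E, s.card ≤ n ∧
    Algebra.IsAlgebraic (IntermediateField.adjoin F (s : Set E)) E

/-- `ed(G₂) ≤ m`: for every field extension `K/F`, every `G₂`-torsor over `K` — equivalently,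
every isomorphism class of `3`-fold quadratic Pfister forms (norm forms of octonion algebras)
over `K` — is defined over an intermediate field `F ⊆ E ⊆ K` with `trdeg_F E ≤ m`. -/
def gTwoEdLE (F : Type u) [Field F] (m : ℕ) : Prop :=
  ∀ (K : Type u) [Field K] [Algebra F K] (a : Fin 2 → Kˣ) (b : K),
    ∃ E : IntermediateField F K, TrdegLE F E m ∧
      ∃ (a' : Fin 2 → (↥E)ˣ) (b' : ↥E),
        QuadraticMap.Equivalent
          (quadPfister (fun i => algebraMap (↥E) K (a' i)) (algebraMap (↥E) K b'))
          (quadPfister (fun i => (a i : K)) b)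


lemma quadPfister_apply {K : Type*} [Field K] {m : ℕ} (a : Fin m → K) (b : K)
    (v : ((Fin m → Bool) × Bool) → K) :
    quadPfister a b v = ∑ S : Fin m → Bool, (∏ i, if S i then a i else 1) *
      (v (S, false) * v (S, false) +
        (v (S, false) * v (S, true) + b * (v (S, true) * v (S, true)))) := by
  change Matrix.toLinearMap₂' K (pfisterMatrix a b) v v = _
  rw [Matrix.toLinearMap₂'_apply]
  simp only [Fintype.sum_prod_type, pfisterMatrix, smul_eq_mul, mul_ite, mul_zero]
  refine Finset.sum_congr rfl fun S _ => ?_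
  simp only [Fintype.sum_bool]
  simp only [Bool.false_eq_true, if_true, if_false, mul_one, add_zero, ite_self]
  simp only [Finset.sum_add_distrib, Finset.sum_ite_eq, Finset.mem_univ, if_true]
  ring

lemma hahn_dom {Γ k : Type*} [AddCommGroup Γ] [LinearOrder Γ] [IsOrderedAddMonoid Γ] [Field k]
    (x y : HahnSeries Γ k) (hx : x ≠ 0) (hy : ∀ g ≤ x.order, y.coeff g = 0) :
    x + y ≠ 0 ∧ (x + y).order = x.order := by
  have h1 : (x + y).coeff x.order ≠ 0 := by
    rw [HahnSeries.coeff_add, hy _ le_rfl, add_zero]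
    exact HahnSeries.coeff_order_eq_zero.not.2 hx
  have h0 : x + y ≠ 0 := fun h => h1 (by rw [h]; rfl)
  refine ⟨h0, le_antisymm (HahnSeries.order_le_of_coeff_ne_zero h1) ?_⟩
  by_contra hlt
  push Not at hlt
  apply HahnSeries.coeff_order_eq_zero.not.2 h0
  rw [HahnSeries.coeff_add, hy _ hlt.le, HahnSeries.coeff_eq_zero_of_lt_order hlt, add_zero]

lemma hahn_sum {Γ k ι : Type*} [AddCommGroup Γ] [LinearOrder Γ] [IsOrderedAddMonoid Γ] [Field k]
    [Fintype ι] (f : ι → HahnSeries Γ k) (i0 : ι) (hi0 : f i0 ≠ 0)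
    (hinj : ∀ i j, f i ≠ 0 → f j ≠ 0 → (f i).order = (f j).order → i = j) :
    ∑ i, f i ≠ 0 := by
  classical
  obtain ⟨i, hi, hmin⟩ := Finset.exists_min_image (Finset.univ.filter fun i => f i ≠ 0)
    (fun i => (f i).order) ⟨i0, by simpa using hi0⟩
  have hi' : f i ≠ 0 := by simpa using hi
  rw [← Finset.add_sum_erase _ _ (Finset.mem_univ i)]
  refine (hahn_dom _ _ hi' fun g hg => ?_).1
  rw [HahnSeries.coeff_sum]
  refine Finset.sum_eq_zero fun j hj => ?_
  by_cases hj0 : f j = 0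
  · rw [hj0]; rfl
  apply HahnSeries.coeff_eq_zero_of_lt_order
  refine lt_of_le_of_lt hg (lt_of_le_of_ne (hmin j (by simpa using hj0)) fun h => ?_)
  exact (Finset.ne_of_mem_erase hj) (hinj i j hi' hj0 h).symm

lemma hahn_norm {Γ k : Type*} [AddCommGroup Γ] [LinearOrder Γ]
    [IsOrderedAddMonoid Γ] [Field k] (e : Γ) (hpos : 0 < e)
    (hne : ∀ α β : Γ, α + α ≠ β + β - e) (u v : HahnSeries Γ k) (h : u ≠ 0 ∨ v ≠ 0) :
    (u * u + (u * v + HahnSeries.single (-e) 1 * (v * v))) ≠ 0 ∧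
    ∃ α : Γ, (u * u + (u * v + HahnSeries.single (-e) 1 * (v * v))).order = α + α ∨
      (u * u + (u * v + HahnSeries.single (-e) 1 * (v * v))).order = α + α - e := by
  have hs : (HahnSeries.single (-e) 1 : HahnSeries Γ k) ≠ 0 := HahnSeries.single_ne_zero one_ne_zero
  have hso : (HahnSeries.single (-e) 1 : HahnSeries Γ k).order = -e :=
    HahnSeries.order_single one_ne_zero
  by_cases hv : v = 0
  · subst hv
    have hu : u ≠ 0 := by simpa using h
    simp only [mul_zero, add_zero]
    exact ⟨mul_ne_zero hu hu, u.order, Or.inl (HahnSeries.order_mul hu hu)⟩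
  have hvv := mul_ne_zero hs (mul_ne_zero hv hv)
  have hvo : (HahnSeries.single (-e) 1 * (v * v)).order = v.order + v.order - e := by
    rw [HahnSeries.order_mul hs (mul_ne_zero hv hv), HahnSeries.order_mul hv hv, hso]; abel
  by_cases hu : u = 0
  · subst hu
    simp only [zero_mul, zero_add]
    exact ⟨hvv, v.order, Or.inr hvo⟩
  have huo := HahnSeries.order_mul hu hu
  have huvo := HahnSeries.order_mul hu hv
  rcases lt_trichotomy (u.order + u.order) (v.order + v.order - e) with hlt | heq | hlt
  · have hd := hahn_dom (u * u) (u * v + HahnSeries.single (-e) 1 * (v * v)) (mul_ne_zero hu hu)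
      (fun g hg => by
        rw [huo] at hg
        rw [HahnSeries.coeff_add, HahnSeries.coeff_eq_zero_of_lt_order,
          HahnSeries.coeff_eq_zero_of_lt_order, add_zero]
        · rw [hvo]; exact lt_of_le_of_lt hg hlt
        · rw [huvo]
          refine lt_of_le_of_lt hg ?_
          have h1 : u.order < v.order := by
            by_contra hcon
            push Not at hcon
            have := add_le_add hcon hcon
            have h2 := sub_lt_self (v.order + v.order) hpos
            exact absurd (this.trans_lt (hlt.trans h2)) (lt_irrefl _)
          gcongr)
    exact ⟨hd.1, u.order, Or.inl (hd.2.trans huo)⟩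
  · exact absurd heq (hne _ _)
  · have hd := hahn_dom (HahnSeries.single (-e) 1 * (v * v)) (u * u + u * v) hvv
      (fun g hg => by
        rw [hvo] at hg
        rw [HahnSeries.coeff_add, HahnSeries.coeff_eq_zero_of_lt_order,
          HahnSeries.coeff_eq_zero_of_lt_order, add_zero]
        · rw [huvo]
          refine lt_of_le_of_lt hg ?_
          by_contra hcon
          push Not at hcon
          have h1 : u.order + e ≤ v.order := by
            have : v.order + (u.order + e) ≤ v.order + v.order := by
              calc _ = u.order + v.order + e := by abel
                _ ≤ v.order + v.order - e + e := by gcongr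
                _ = _ := by abel
            exact le_of_add_le_add_left this
          have h2 := add_le_add h1 h1
          have h3 : u.order + u.order + e ≤ v.order + v.order - e := by
            rw [le_sub_iff_add_le]
            refine le_trans (le_of_eq ?_) h2
            abel
          have h4 := lt_add_of_pos_right (u.order + u.order) hpos
          exact absurd ((h4.trans_le h3).trans hlt) (lt_irrefl _)
        · rw [huo]; exact lt_of_le_of_lt hg hlt)
    rw [← add_assoc, add_comm (u * u + u * v)]
    exact ⟨hd.1, v.order, Or.inr (hd.2.trans hvo)⟩

abbrev GG := Lex (Fin 3 → ℤ)

def ee (i : Fin 3) : GG := toLex (Pi.single i 1)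

def cr (i : Fin 3) : GG →+ ℤ where
  toFun α := ofLex α i
  map_zero' := rfl
  map_add' _ _ := rfl

lemma cr_ee (i j : Fin 3) : cr i (ee j) = if i = j then 1 else 0 := by
  change (Pi.single j 1 : Fin 3 → ℤ) i = _
  rw [Pi.single_apply]

lemma ee_pos : 0 < ee 2 := by
  refine ⟨2, fun j hj => ?_, ?_⟩
  · have : j ≠ 2 := hj.ne
    change 0 = cr j (ee 2)
    rw [cr_ee, if_neg this]
  · change 0 < cr 2 (ee 2)
    rw [cr_ee]; simp

lemma ee_ne (α β : GG) : α + α ≠ β + β - ee 2 := by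
  intro h
  have := congrArg (cr 2) h
  simp only [map_add, map_sub, cr_ee, if_true] at this
  omega

lemma hahn_aniso {k : Type*} [Field k] (v : ((Fin 2 → Bool) × Bool) → HahnSeries GG k) (hv : v ≠ 0) :
    quadPfister (fun i : Fin 2 => (HahnSeries.single (ee (Fin.castSucc i)) 1 : HahnSeries GG k))
      (HahnSeries.single (-ee 2) 1) v ≠ 0 := by
  rw [quadPfister_apply]
  set c : (Fin 2 → Bool) → HahnSeries GG k := fun S =>
    ∏ i : Fin 2, if S i then (HahnSeries.single (ee (Fin.castSucc i)) 1 : HahnSeries GG k) else 1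
    with hc
  set N : (Fin 2 → Bool) → HahnSeries GG k := fun S => v (S, false) * v (S, false) +
        (v (S, false) * v (S, true) + HahnSeries.single (-ee 2) 1 * (v (S, true) * v (S, true)))
    with hN
  have hc0 (S) : c S ≠ 0 := by
    rw [hc]
    refine Finset.prod_ne_zero_iff.2 fun i _ => ?_
    split_ifs
    · exact HahnSeries.single_ne_zero one_ne_zero
    · exact one_ne_zero
  have hco (S) : (c S).order = (if S 0 then ee 0 else 0) + (if S 1 then ee 1 else 0) := by
    simp only [hc, Fin.prod_univ_two]
    rw [HahnSeries.order_mul]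
    · congr 1
      · split_ifs
        · exact HahnSeries.order_single one_ne_zero
        · exact HahnSeries.order_one
      · split_ifs
        · exact HahnSeries.order_single one_ne_zero
        · exact HahnSeries.order_one
    · split_ifs
      · exact HahnSeries.single_ne_zero one_ne_zero
      · exact one_ne_zero
    · split_ifs
      · exact HahnSeries.single_ne_zero one_ne_zero
      · exact one_ne_zero
  have hNS (S) (h : N S ≠ 0) : ∃ α β : GG, (N S).order = α + α + β ∧ cr 0 β = 0 ∧ cr 1 β = 0 := by
    have : v (S, false) ≠ 0 ∨ v (S, true) ≠ 0 := by
      by_contra hcon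
      push Not at hcon
      apply h
      simp [hN, hcon.1, hcon.2]
    obtain ⟨-, α, h1 | h1⟩ := hahn_norm (ee 2) ee_pos ee_ne _ _ this
    · exact ⟨α, 0, by rw [add_zero]; exact h1, map_zero _, map_zero _⟩
    · exact ⟨α, -ee 2, by rw [← sub_eq_add_neg]; exact h1, by simp [cr_ee], by simp [cr_ee]⟩
  obtain ⟨⟨S0, b0⟩, h0⟩ := Function.ne_iff.1 hv
  refine hahn_sum (fun S => c S * N S) S0 ?_ ?_
  · refine mul_ne_zero (hc0 S0) (hahn_norm (ee 2) ee_pos ee_ne _ _ ?_).1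
    cases b0
    · exact Or.inl h0
    · exact Or.inr h0
  · intro S T hS hT hST
    have hS' := right_ne_zero_of_mul hS
    have hT' := right_ne_zero_of_mul hT
    obtain ⟨α, β, h1, h2, h3⟩ := hNS S hS'
    obtain ⟨γ, δ, h4, h5, h6⟩ := hNS T hT'
    rw [HahnSeries.order_mul (hc0 S) hS', HahnSeries.order_mul (hc0 T) hT', hco, hco, h1, h4] at hST
    have e0 := congrArg (cr 0) hST
    have e1 := congrArg (cr 1) hST
    simp only [map_add, h2, h3, h5, h6, apply_ite (cr 0), apply_ite (cr 1), cr_ee, map_zero] at e0 e1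
    simp only [Fin.isValue, one_ne_zero, zero_ne_one, if_true, if_false, ite_self] at e0 e1
    ext i
    fin_cases i
    · change S 0 = T 0
      cases hs : S 0 <;> cases ht : T 0 <;> simp [hs, ht] at e0 ⊢ <;> omega
    · change S 1 = T 1
      cases hs : S 1 <;> cases ht : T 1 <;> simp [hs, ht] at e1 ⊢ <;> omega

/-- quadratic `C_i` property for systems -/
def TL (i : ℕ) (k : Type u) [Field k] : Prop :=
  ∀ (V W : Type u) [AddCommGroup V] [Module k V] [AddCommGroup W] [Module k W]
    [FiniteDimensional k V] [FiniteDimensional k W] (B : V →ₗ[k] V →ₗ[k] W),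
    2 ^ i * Module.finrank k W < Module.finrank k V → ∃ v : V, v ≠ 0 ∧ B v v = 0

open MvPolynomial in
lemma height_origin (k : Type u) [Field k] (n : ℕ) :
    (n : ℕ∞) ≤ (vanishingIdeal k {(0 : Fin n → k)}).height := by
  let φ (i : ℕ) : MvPolynomial (Fin n) k →ₐ[k] MvPolynomial (Fin n) k :=
    aeval (fun j => if (j : ℕ) < i then 0 else X j)
  have hp (i : ℕ) : (RingHom.ker (φ i)).IsPrime := RingHom.ker_isPrime _
  have hle (i : ℕ) : RingHom.ker (φ i) ≤ RingHom.ker (φ (i + 1)) := by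
    intro p h
    rw [RingHom.mem_ker] at h ⊢
    have : φ (i+1) = (φ (i+1)).comp (φ i) := by
      ext j : 1
      simp only [φ, AlgHom.comp_apply, aeval_X]
      split_ifs with h1 h2 h2
      · simp
      · rw [aeval_X, if_pos h1]
      · omega
      · rw [aeval_X, if_neg h1]
    rw [this, AlgHom.comp_apply, h, map_zero]
  have key (i : ℕ) (hi : i ≤ n) : (i : ℕ∞) ≤ (RingHom.ker (φ i)).height := by
    induction i with
    | zero => simp
    | succ i ih =>
      have hlt : RingHom.ker (φ i) < RingHom.ker (φ (i + 1)) := by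
        refine lt_of_le_of_ne (hle i) fun h => ?_
        have : (X ⟨i, hi⟩ : MvPolynomial (Fin n) k) ∈ RingHom.ker (φ (i + 1)) := by
          rw [RingHom.mem_ker]; simp [φ]
        rw [← h, RingHom.mem_ker] at this
        simp [φ] at this
      have := Ideal.height_add_one_le_of_lt_of_isPrime hlt
      refine le_trans ?_ this
      push_cast
      gcongr
      exact ih (by omega)
  refine (key n le_rfl).trans (Ideal.height_mono ?_)
  intro p h
  rw [RingHom.mem_ker] at h
  rw [mem_vanishingIdeal_singleton_iff]
  have : (aeval (0 : Fin n → k) : MvPolynomial (Fin n) k →ₐ[k] k) = (aeval (0 : Fin n → k)).comp (φ n) := by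
    ext j : 1
    simp [φ]
  rw [this, AlgHom.comp_apply, h, map_zero]

open MvPolynomial in
lemma TL_zero (k : Type u) [Field k] [IsAlgClosed k] : TL 0 k := by
  intro V W _ _ _ _ _ _ B h
  by_contra hcon
  push Not at hcon
  rw [pow_zero, one_mul] at h
  let n := Module.finrank k V
  let r := Module.finrank k W
  let bV := Module.finBasis k V
  let bW := Module.finBasis k W
  let f : Fin r → MvPolynomial (Fin n) k := fun l =>
    ∑ i, ∑ j, C (bW.repr (B (bV i) (bV j)) l) * X i * X j
  have hf (l : Fin r) (x : Fin n → k) :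
      aeval x (f l) = bW.repr (B (bV.equivFun.symm x) (bV.equivFun.symm x)) l := by
    simp only [f, Module.Basis.equivFun_symm_apply, map_sum, LinearMap.sum_apply, map_smul,
      LinearMap.smul_apply, Finsupp.coe_finsetSum, Finset.sum_apply, Finsupp.smul_apply, smul_eq_mul,
      map_mul, aeval_C, aeval_X, Algebra.algebraMap_self, RingHom.id_apply, Finset.mul_sum]
    rw [Finset.sum_comm]
    refine Finset.sum_congr rfl fun i _ => Finset.sum_congr rfl fun j _ => by ring
  let I := Ideal.span (Set.range f)
  have hz : zeroLocus k I = {0} := by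
    rw [zeroLocus_span]
    ext x
    simp only [Set.mem_range, forall_exists_index, forall_apply_eq_imp_iff, Set.mem_ofPred_eq,
      Set.mem_singleton_iff]
    simp only [hf]
    constructor
    · intro hx
      by_contra hx0
      refine hcon (bV.equivFun.symm x) ((LinearEquiv.map_ne_zero_iff _).2 hx0) ?_
      apply bW.repr.injective
      ext l
      simpa using hx l
    · rintro rfl l
      simp
  have hrad := vanishingIdeal_zeroLocus_eq_radical (k := k) (K := k) I
  rw [hz] at hrad
  have hmin : vanishingIdeal k {(0 : Fin n → k)} ∈ I.minimalPrimes := by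
    rw [← Ideal.radical_minimalPrimes, ← hrad, Ideal.minimalPrimes_eq_subsingleton_self]
    simp
  have h1 := Ideal.height_le_card_of_mem_minimalPrimes_span (Set.finite_range f) hmin
  have h2 := height_origin k n
  have h3 : ((Set.range f).ncard : ℕ∞) ≤ r := by
    have := Set.ncard_image_le (f := f) Set.finite_univ
    rw [Set.image_univ] at this
    exact_mod_cast this.trans (by simp)
  have h4 := h2.trans (h1.trans h3)
  have : n ≤ r := by exact_mod_cast h4
  omega

lemma TL_mono (i : ℕ) (k : Type u) [Field k] (h : TL i k) : TL (i+1) k := by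
  intro V W _ _ _ _ _ _ B hlt
  refine h V W B (lt_of_le_of_lt ?_ hlt)
  gcongr <;> omega

lemma TL_finite (i : ℕ) (k L : Type u) [Field k] [Field L] [Algebra k L] [FiniteDimensional k L]
    (h : TL i k) : TL i L := by
  intro V W _ _ _ _ _ _ B hlt
  let : Module k V := Module.compHom V (algebraMap k L)
  let : Module k W := Module.compHom W (algebraMap k L)
  have : IsScalarTower k L V := IsScalarTower.of_algebraMap_smul fun _ _ => rfl
  have : IsScalarTower k L W := IsScalarTower.of_algebraMap_smul fun _ _ => rfl
  have : FiniteDimensional k V := FiniteDimensional.trans k L V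
  have : FiniteDimensional k W := FiniteDimensional.trans k L W
  let B' : V →ₗ[k] V →ₗ[k] W := LinearMap.mk₂ k (fun v w => B v w) (by simp)
    (by intro c m n; rw [← algebraMap_smul L c m]; simp)
    (by simp)
    (by intro c m n; rw [← algebraMap_smul L c n]; simp)
  refine h V W B' ?_
  rw [← Module.finrank_mul_finrank k L V, ← Module.finrank_mul_finrank k L W]
  have : 0 < Module.finrank k L := Module.finrank_pos
  nlinarith

open Polynomial in
lemma exists_common_denom (k L : Type u) [Field k] [Field L] [Algebra k L] (t : L)
    (hL : ∀ x : L, ∃ p q : k[X], aeval t q ≠ 0 ∧ aeval t q * x = aeval t p) (s : Finset L) :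
    ∃ D : k[X], aeval t D ≠ 0 ∧ ∀ x ∈ s, ∃ p : k[X], aeval t D * x = aeval t p := by
  classical
  induction s using Finset.induction_on with
  | empty => exact ⟨1, by simp, by simp⟩
  | insert a s _ ih =>
    obtain ⟨D, hD, h⟩ := ih
    obtain ⟨p, q, hq, hp⟩ := hL a
    refine ⟨D * q, by simp [hD, hq], fun x hx => ?_⟩
    rcases Finset.mem_insert.1 hx with rfl | hx
    · exact ⟨D * p, by rw [map_mul, map_mul, mul_assoc, hp]⟩
    · obtain ⟨p', hp'⟩ := h x hx
      exact ⟨q * p', by rw [map_mul, map_mul, ← hp']; ring⟩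

open Polynomial in
lemma TL_trans (i : ℕ) (k L : Type u) [Field k] [Field L] [Algebra k L] (t : L)
    (ht : Transcendental k t)
    (hL : ∀ x : L, ∃ p q : k[X], aeval t q ≠ 0 ∧ aeval t q * x = aeval t p)
    (h : TL i k) : TL (i + 1) L := by
  classical
  intro V W _ _ _ _ _ _ B hlt
  set n := Module.finrank L V
  set r := Module.finrank L W
  let bV := Module.finBasis L V
  let bW := Module.finBasis L W
  let co : Fin n × Fin n × Fin r → L := fun z => bW.repr (B (bV z.1) (bV z.2.1)) z.2.2
  obtain ⟨D, hD, hs⟩ := exists_common_denom k L t hL (Finset.univ.image co)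
  have hs' : ∀ z, ∃ p : k[X], aeval t D * co z = aeval t p := fun z => hs _ (by simp)
  choose p hp using hs'
  obtain ⟨c, hc⟩ : ∃ c, ∀ z, (p z).natDegree ≤ c :=
    ⟨Finset.univ.sup fun z => (p z).natDegree, fun z => Finset.le_sup (f := fun z => (p z).natDegree) (Finset.mem_univ z)⟩
  let N := 2 ^ i * r * c
  let M := 2 * N + c + 1
  let ι : (Fin n → degreeLT k (N+1)) →ₗ[k] (Fin n → k[X]) :=
    LinearMap.pi fun j => (degreeLT k (N+1)).subtype ∘ₗ LinearMap.proj j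
  let B0 : (Fin n → k[X]) →ₗ[k] (Fin n → k[X]) →ₗ[k] (Fin r → Fin M → k) :=
    LinearMap.mk₂ k (fun f g l m => (∑ a, ∑ b, f a * g b * p (a, b, l)).coeff m)
      (by intro f f' g; ext l m; simp [add_mul, Finset.sum_add_distrib])
      (by intro x f g; ext l m; simp [Finset.mul_sum])
      (by intro f g g'; ext l m; simp [add_mul, mul_add, Finset.sum_add_distrib])
      (by intro x f g; ext l m; simp [Finset.mul_sum])
  have hfin : Module.finrank k (degreeLT k (N+1)) = N + 1 := by
    rw [(degreeLTEquiv k (N+1)).finrank_eq]; simp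
  have : FiniteDimensional k (degreeLT k (N+1)) := (degreeLTEquiv k (N+1)).symm.finiteDimensional
  obtain ⟨f, hf0, hf⟩ := h (Fin n → degreeLT k (N+1)) (Fin r → Fin M → k)
    (B0.compl₁₂ ι ι) (by
      have e1 : Module.finrank k (Fin r → Fin M → k) = r * M := by
        rw [Module.finrank_pi_fintype]; simp
      have e2 : Module.finrank k (Fin n → degreeLT k (N+1)) = n * (N + 1) := by
        rw [Module.finrank_pi_fintype]; simp [hfin]
      rw [e1, e2]
      have h1 : 2 ^ (i+1) * r + 1 ≤ n := hlt
      calc 2 ^ i * (r * M) < (2 ^ (i+1) * r + 1) * (N + 1) := by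
            simp only [M, N, pow_succ]
            generalize 2 ^ i = e
            nlinarith [Nat.zero_le (e * r)]
        _ ≤ _ := by gcongr)
  have hzero (l : Fin r) : ∑ a, ∑ b, (f a : k[X]) * (f b : k[X]) * p (a, b, l) = 0 := by
    ext m
    by_cases hm : m < M
    · have := congrFun (congrFun hf l) ⟨m, hm⟩
      simpa [B0, ι] using this
    · rw [coeff_zero]
      apply coeff_eq_zero_of_natDegree_lt
      refine lt_of_le_of_lt ?_ (lt_of_lt_of_le (Nat.lt_succ_self (2 * N + c)) (not_lt.1 hm))
      have hd (a) : (f a : k[X]).natDegree ≤ N := by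
        have := mem_degreeLT.1 (f a).2
        rw [← Nat.lt_succ_iff]
        by_cases h0 : (f a : k[X]) = 0
        · simp [h0]
        · exact (natDegree_lt_iff_degree_lt h0).2 this
      refine natDegree_sum_le_of_forall_le _ _ fun a _ => natDegree_sum_le_of_forall_le _ _ fun b _ => ?_
      refine natDegree_mul_le.trans ?_
      refine (add_le_add natDegree_mul_le le_rfl).trans ?_
      have := hd a
      have := hd b
      have := hc (a, b, l)
      omega
  refine ⟨∑ a, aeval t (f a : k[X]) • bV a, ?_, ?_⟩
  · intro h0
    apply hf0
    ext1 a
    have := Fintype.linearIndependent_iff.1 bV.linearIndependent _ h0 a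
    have h2 : (f a : k[X]) = 0 := by
      by_contra h3
      exact ht ⟨_, h3, this⟩
    exact Subtype.ext h2
  · apply bW.repr.injective
    ext l
    have h3 := congrArg (aeval t) (hzero l)
    simp only [map_sum, map_mul, ← hp, map_zero] at h3
    rw [map_zero, Finsupp.zero_apply]
    refine (mul_eq_zero.1 (Eq.trans ?_ h3)).resolve_left hD
    simp only [map_sum, LinearMap.sum_apply, map_smul, co,
      LinearMap.smul_apply, Finsupp.coe_finsetSum, Finset.sum_apply, Finsupp.smul_apply, smul_eq_mul,
      Finset.mul_sum]
    rw [Finset.sum_comm]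
    refine Finset.sum_congr rfl fun i _ => Finset.sum_congr rfl fun j _ => by ring

open IntermediateField Polynomial in
lemma TL_adjoin (i : ℕ) (k K : Type u) [Field k] [Field K] [Algebra k K] (t : K)
    (h : TL i k) : TL (i + 1) k⟮t⟯ := by
  by_cases ht : IsAlgebraic k t
  · have : FiniteDimensional k k⟮t⟯ := adjoin.finiteDimensional ht.isIntegral
    exact TL_mono _ _ (TL_finite i k _ h)
  · have hg (p : k[X]) : algebraMap k⟮t⟯ K (aeval (AdjoinSimple.gen k t) p) = aeval t p := by
      rw [← aeval_algebraMap_apply, AdjoinSimple.algebraMap_gen]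
    refine TL_trans i k _ (AdjoinSimple.gen k t) ?_ ?_ h
    · intro h'
      apply ht
      have := h'.algebraMap (A := K)
      simpa using this
    · rintro ⟨x, hx⟩
      obtain ⟨p, q, rfl⟩ := (mem_adjoin_simple_iff k x).1 hx
      by_cases hq : aeval t q = 0
      · refine ⟨0, 1, by simp, ?_⟩
        apply (algebraMap k⟮t⟯ K).injective
        simp [hq]
      · refine ⟨p, q, fun h0 => hq ?_, ?_⟩
        · rw [← hg, h0, map_zero]
        · apply (algebraMap k⟮t⟯ K).injective
          rw [map_mul, hg, hg]
          exact mul_div_cancel₀ _ hq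

lemma finset_pair {E : Type*} [Zero E] (s : Finset E) (h : s.card ≤ 2) :
    ∃ x y : E, ∀ z ∈ s, z = x ∨ z = y := by
  classical
  rcases Nat.lt_or_ge s.card 1 with h0 | h1
  · refine ⟨0, 0, ?_⟩
    have : s = ∅ := Finset.card_eq_zero.1 (by omega)
    simp [this]
  · rcases Nat.lt_or_ge s.card 2 with h2 | h2
    · obtain ⟨x, rfl⟩ := Finset.card_eq_one.1 (by omega : s.card = 1)
      exact ⟨x, x, by simp⟩
    · obtain ⟨x, y, _, rfl⟩ := Finset.card_eq_two.1 (by omega : s.card = 2)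
      exact ⟨x, y, by simp⟩

lemma isAlg_transfer {A E L K : Type*} [Field A] [Field E] [Field L] [Field K] [Algebra A E]
    [Algebra E K] [Algebra L K] (f : A →+* L)
    (hf : ∀ w, algebraMap L K (f w) = algebraMap E K (algebraMap A E w)) (z : E)
    (hz : IsAlgebraic A z) : IsAlgebraic L (algebraMap E K z) := by
  obtain ⟨p, hp0, hp⟩ := hz
  refine ⟨p.map f, (Polynomial.map_ne_zero_iff f.injective).2 hp0, ?_⟩
  have hc : (algebraMap L K).comp f = (algebraMap E K).comp (algebraMap A E) := RingHom.ext hf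
  rw [Polynomial.aeval_def, Polynomial.eval₂_map, hc, ← Polynomial.hom_eval₂,
    ← Polynomial.aeval_def, hp, map_zero]

open IntermediateField in
lemma isotropic_of_trdeg (F k K : Type u) [Field F] [Field k] [Field K] [Algebra F k] [Algebra k K]
    [Algebra F K] [IsScalarTower F k K] [IsAlgClosed k] (E : IntermediateField F K)
    (hE : TrdegLE F E 2) (a : Fin 2 → E) (b : E) :
    ∃ v, v ≠ 0 ∧ quadPfister (fun i => algebraMap E K (a i)) (algebraMap E K b) v = 0 := by
  obtain ⟨s, hs, halg⟩ := hE
  obtain ⟨x, y, hxy⟩ := finset_pair s hs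
  let L1 := k⟮(x : K)⟯
  let L2 := L1⟮(y : K)⟯
  have hL2 : TL 2 L2 := TL_adjoin 1 L1 K y (TL_adjoin 0 k K x (TL_zero k))
  have hx : (x : K) ∈ L2 := L2.algebraMap_mem (⟨x, mem_adjoin_simple_self k (x : K)⟩ : L1)
  have hy : (y : K) ∈ L2 := mem_adjoin_simple_self L1 (y : K)
  have hmem (w : E) (hw : w ∈ adjoin F (s : Set E)) : (w : K) ∈ L2 := by
    induction hw using adjoin_induction with
    | mem z hz =>
      rcases hxy z (by simpa using hz) with rfl | rfl
      · exact hx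
      · exact hy
    | algebraMap z =>
      have : ((algebraMap F E z : E) : K) = algebraMap L1 K (algebraMap k L1 (algebraMap F k z)) := by
        rw [← IsScalarTower.algebraMap_apply k L1 K, ← IsScalarTower.algebraMap_apply F k K]
        rfl
      rw [this]
      exact L2.algebraMap_mem _
    | add z w _ _ h1 h2 => exact L2.add_mem h1 h2
    | inv z _ h1 => exact L2.inv_mem h1
    | mul z w _ _ h1 h2 => exact L2.mul_mem h1 h2
  let f : adjoin F (s : Set E) →+* L2 :=
    ((algebraMap E K).comp (algebraMap (adjoin F (s : Set E)) E)).codRestrict L2.toSubfield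
      (fun w => hmem w.1 w.2)
  have hal (z : E) : IsIntegral L2 (z : K) := by
    have h1 := isAlg_transfer (A := adjoin F (s : Set E)) (E := E) (L := L2) (K := K) f
      (fun _ => rfl) z (halg.isAlgebraic z)
    exact h1.isIntegral
  let T : Set K := {(a 0 : K), (a 1 : K), (b : K)}
  have : Finite T := by
    have : T.Finite := by simp [T]
    exact this
  have hT : ∀ z ∈ T, IsIntegral L2 z := by
    intro z hz
    simp only [T, Set.mem_insert_iff, Set.mem_singleton_iff] at hz
    rcases hz with rfl | rfl | rfl <;> exact hal _
  let M := adjoin L2 T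
  have : FiniteDimensional L2 M := finiteDimensional_adjoin hT
  have hM : TL 2 M := TL_finite 2 L2 M hL2
  have ha (i : Fin 2) : (a i : K) ∈ M := by
    apply subset_adjoin
    fin_cases i <;> simp [T]
  have hb : (b : K) ∈ M := by
    apply subset_adjoin
    simp [T]
  obtain ⟨v, hv0, hv⟩ := hM (((Fin 2 → Bool) × Bool) → M) M
    (Matrix.toLinearMap₂' M (pfisterMatrix (fun i => (⟨a i, ha i⟩ : M)) ⟨b, hb⟩)) (by simp)
  refine ⟨fun j => (v j : K), ?_, ?_⟩
  · intro h
    apply hv0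
    ext j
    exact congrFun h j
  · have h1 : quadPfister (fun i => (⟨a i, ha i⟩ : M)) ⟨b, hb⟩ v = 0 := hv
    rw [quadPfister_apply] at h1 ⊢
    have h2 := congrArg (algebraMap M K) h1
    simp only [map_sum, map_mul, map_add, map_zero, map_prod, apply_ite (algebraMap M K), map_one] at h2
    exact h2

lemma gTwoEdLE_three (F : Type u) [Field F] : gTwoEdLE F 3 := by
  classical
  intro K _ _ a b
  let T : Set K := {(a 0 : K), (a 1 : K), b}
  let E := IntermediateField.adjoin F T
  have ha (i : Fin 2) : (a i : K) ∈ E := by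
    apply IntermediateField.subset_adjoin
    fin_cases i <;> simp [T]
  have hb : b ∈ E := by
    apply IntermediateField.subset_adjoin
    simp [T]
  refine ⟨E, ⟨{⟨a 0, ha 0⟩, ⟨a 1, ha 1⟩, ⟨b, hb⟩}, Finset.card_le_three, ?_⟩,
    fun i => Units.mk0 ⟨a i, ha i⟩ (fun h => (a i).ne_zero (congrArg Subtype.val h)), ⟨b, hb⟩,
    QuadraticMap.Equivalent.refl _⟩
  refine ⟨fun x => ?_⟩
  have hx : x ∈ IntermediateField.adjoin F
      ((({⟨a 0, ha 0⟩, ⟨a 1, ha 1⟩, ⟨b, hb⟩} : Finset E)) : Set E) := by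
    have key : ∀ (y : K) (hy : y ∈ E), (⟨y, hy⟩ : E) ∈ IntermediateField.adjoin F
      ((({⟨a 0, ha 0⟩, ⟨a 1, ha 1⟩, ⟨b, hb⟩} : Finset E)) : Set E) := by
      intro y hy
      induction hy using IntermediateField.adjoin_induction with
      | mem z hz =>
        apply IntermediateField.subset_adjoin
        simp only [T, Set.mem_insert_iff, Set.mem_singleton_iff] at hz
        rcases hz with rfl | rfl | rfl <;> simp
      | algebraMap z => exact IntermediateField.algebraMap_mem _ z
      | add z w _ _ h1 h2 => exact add_mem h1 h2
      | inv z _ h1 => exact inv_mem h1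
      | mul z w _ _ h1 h2 => exact mul_mem h1 h2
    exact key x.1 x.2
  exact isAlgebraic_algebraMap (⟨x, hx⟩ : IntermediateField.adjoin F _)

lemma TrdegLE.mono {F E : Type*} [Field F] [Field E] [Algebra F E] {m n : ℕ} (h : m ≤ n)
    (H : TrdegLE F E m) : TrdegLE F E n := by
  obtain ⟨s, hs, h'⟩ := H
  exact ⟨s, hs.trans h, h'⟩

lemma three_le_of_gTwoEdLE (F : Type u) [Field F] (m : ℕ) (h : gTwoEdLE F m) : 3 ≤ m := by
  by_contra hm
  let k := AlgebraicClosure F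
  let K := HahnSeries GG k
  let alg : Algebra F K := ((algebraMap k K).comp (algebraMap F k)).toAlgebra
  have htow : @IsScalarTower F k K _ _ alg.toSMul := 
    @IsScalarTower.of_algebraMap_eq F k K _ _ _ _ _ alg (fun _ => rfl)
  obtain ⟨E, hE, a', b', ⟨e⟩⟩ := @h K _ alg
    (fun i => Units.mk0 (HahnSeries.single (ee (Fin.castSucc i)) 1)
      (HahnSeries.single_ne_zero one_ne_zero)) (HahnSeries.single (-ee 2) 1)
  obtain ⟨v, hv0, hv⟩ := @isotropic_of_trdeg F k K _ _ _ _ _ alg htow _ E (hE.mono (by omega))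
    (fun i => (a' i : E)) b'
  refine hahn_aniso (e v) ?_ ((e.map_app v).trans hv)
  intro h0
  exact hv0 (e.toLinearEquiv.map_eq_zero_iff.1 h0)

/-- Over a field `F` of characteristic `2`, the essential dimension of the
split algebraic group `G₂` (i.e. of the functor `K ↦ G₂`-torsors over `K`, equivalently
`K ↦` isomorphism classes of `3`-fold quadratic Pfister forms over `K`) equals `3`:
`ed(G₂) ≤ 3`, and `3 ≤ m` for every `m` with `ed(G₂) ≤ m`. -/
theorem ed_gTwo_eq (F : Type u) [Field F] [CharP F 2] :
    gTwoEdLE F 3 ∧ ∀ m : ℕ, gTwoEdLE F m → 3 ≤ m := by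
  exact ⟨gTwoEdLE_three F, three_le_of_gTwoEdLE F⟩

end
end

section
/- With notation as in the construction (F̄ algebraically closed of characteristic 2, K = F̄(x,y), D = (K_{x,y}(s,t), us, vt, wst) a division algebra of degree 4 over K(s,t) with v = g + β, g ∈ K nonzero): the 4-fold Pfister form in Tignol's decomposition of the second trace form φ_D is φ_{4,D} = ⟨⟨s, t, g² + g + y, x]], and this form is anisotropic over F̄(x, y, s, t). -/
/-!
Statement 11: With notation as in the construction (`F` algebraically closed of characteristic
`2`, `K = F(x,y)`, `D = (K_{x,y}(s,t), us, vt, wst)` a division algebra of degree `4` over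
`K(s,t)` with `v = g + β`, `g ∈ K` nonzero): the `4`-fold Pfister form in Tignol's
decomposition `φ_D = [1,1] + φ_{2,D} + φ_{4,D}` (in the Witt group `W_q(K(s,t))`) of the second
trace form `φ_D : q ↦ s₂(q)` is `φ_{4,D} = ⟨⟨s, t, g² + g + y, x]]`, and this form is
anisotropic over `F(x, y, s, t) = K(s,t)`.

Here `s₂(q)` is the second coefficient of the reduced characteristic polynomial
`Prd_{D,q}(X) = X⁴ - s₁(q)X³ + s₂(q)X² - s₃(q)X + s₄(q)`, which is the unique monic polynomial
`p` with `p⁴ = ` the characteristic polynomial of left multiplication by `q` on `D`; equality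
in the Witt group `W_q` is Witt equivalence, i.e. isometry after adding hyperbolic planes.
-/

universe u

noncomputable section

open scoped TensorProduct

/-- The defining relations of the abelian crossed product `(K_{a,b}, u, v, w)` where
`u = u₀ + u₁α ∈ K_a`, `v = v₀ + v₁β ∈ K_b`, `w = w₀ + w₁(α+β) ∈ K_{a+b}` (characteristic `2`).
The generators `0, 1, 2, 3` of the free algebra stand for `α, β, λ, δ` respectively. -/
inductive CrossedRel (K : Type u) [CommRing K] (a b u0 u1 v0 v1 w0 w1 : K) :
    FreeAlgebra K (Fin 4) → FreeAlgebra K (Fin 4) → Prop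
  /-- `α² + α = a` -/
  | alpha_sq : CrossedRel K a b u0 u1 v0 v1 w0 w1
      (FreeAlgebra.ι K (0 : Fin 4) * FreeAlgebra.ι K 0 + FreeAlgebra.ι K 0)
      (algebraMap K _ a)
  /-- `β² + β = b` -/
  | beta_sq : CrossedRel K a b u0 u1 v0 v1 w0 w1
      (FreeAlgebra.ι K (1 : Fin 4) * FreeAlgebra.ι K 1 + FreeAlgebra.ι K 1)
      (algebraMap K _ b)
  /-- `αβ = βα` -/
  | alpha_beta : CrossedRel K a b u0 u1 v0 v1 w0 w1
      (FreeAlgebra.ι K (0 : Fin 4) * FreeAlgebra.ι K 1)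
      (FreeAlgebra.ι K (1 : Fin 4) * FreeAlgebra.ι K 0)
  /-- `λα = σ(α)λ = αλ` -/
  | lambda_alpha : CrossedRel K a b u0 u1 v0 v1 w0 w1
      (FreeAlgebra.ι K (2 : Fin 4) * FreeAlgebra.ι K 0)
      (FreeAlgebra.ι K (0 : Fin 4) * FreeAlgebra.ι K 2)
  /-- `λβ = σ(β)λ = (β+1)λ` -/
  | lambda_beta : CrossedRel K a b u0 u1 v0 v1 w0 w1
      (FreeAlgebra.ι K (2 : Fin 4) * FreeAlgebra.ι K 1)
      (FreeAlgebra.ι K (1 : Fin 4) * FreeAlgebra.ι K 2 + FreeAlgebra.ι K 2)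
  /-- `δβ = τ(β)δ = βδ` -/
  | delta_beta : CrossedRel K a b u0 u1 v0 v1 w0 w1
      (FreeAlgebra.ι K (3 : Fin 4) * FreeAlgebra.ι K 1)
      (FreeAlgebra.ι K (1 : Fin 4) * FreeAlgebra.ι K 3)
  /-- `δα = τ(α)δ = (α+1)δ` -/
  | delta_alpha : CrossedRel K a b u0 u1 v0 v1 w0 w1
      (FreeAlgebra.ι K (3 : Fin 4) * FreeAlgebra.ι K 0)
      (FreeAlgebra.ι K (0 : Fin 4) * FreeAlgebra.ι K 3 + FreeAlgebra.ι K 3)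
  /-- `λ² = u = u₀ + u₁α` -/
  | lambda_sq : CrossedRel K a b u0 u1 v0 v1 w0 w1
      (FreeAlgebra.ι K (2 : Fin 4) * FreeAlgebra.ι K 2)
      (algebraMap K _ u0 + algebraMap K _ u1 * FreeAlgebra.ι K 0)
  /-- `δ² = v = v₀ + v₁β` -/
  | delta_sq : CrossedRel K a b u0 u1 v0 v1 w0 w1
      (FreeAlgebra.ι K (3 : Fin 4) * FreeAlgebra.ι K 3)
      (algebraMap K _ v0 + algebraMap K _ v1 * FreeAlgebra.ι K 1)
  /-- `(λδ)² = w = w₀ + w₁(α+β)` -/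
  | lambda_delta_sq : CrossedRel K a b u0 u1 v0 v1 w0 w1
      (FreeAlgebra.ι K (2 : Fin 4) * FreeAlgebra.ι K 3 *
        (FreeAlgebra.ι K (2 : Fin 4) * FreeAlgebra.ι K 3))
      (algebraMap K _ w0 +
        algebraMap K _ w1 * (FreeAlgebra.ι K (0 : Fin 4) + FreeAlgebra.ι K 1))

/-- The abelian crossed product `(K_{a,b}, u₀ + u₁α, v₀ + v₁β, w₀ + w₁(α+β))`:
the `K`-algebra presented by generators `α, β, λ, δ` and the relations above. -/
def CrossedProd (K : Type u) [CommRing K] (a b u0 u1 v0 v1 w0 w1 : K) : Type u :=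
  RingQuot (CrossedRel K a b u0 u1 v0 v1 w0 w1)

instance (K : Type u) [CommRing K] (a b u0 u1 v0 v1 w0 w1 : K) :
    Ring (CrossedProd K a b u0 u1 v0 v1 w0 w1) :=
  inferInstanceAs (Ring (RingQuot (CrossedRel K a b u0 u1 v0 v1 w0 w1)))

instance (K : Type u) [CommRing K] (a b u0 u1 v0 v1 w0 w1 : K) :
    Algebra K (CrossedProd K a b u0 u1 v0 v1 w0 w1) :=
  inferInstanceAs (Algebra K (RingQuot (CrossedRel K a b u0 u1 v0 v1 w0 w1)))

/-- A finite-dimensional `K`-algebra is split if it is isomorphic to a matrix algebra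
`M_n(K)`. -/
def IsSplitAlg (K : Type*) (A : Type*) [Field K] [Ring A] [Algebra K A] : Prop :=
  ∃ n : ℕ, 0 < n ∧ Nonempty (A ≃ₐ[K] Matrix (Fin n) (Fin n) K)

/-- `A` is a division algebra (for a central simple algebra of degree `4` this says exactly
`ind(A) = 4`). -/
def IsDivisionAlg (A : Type*) [Ring A] : Prop :=
  Nontrivial A ∧ ∀ z : A, z ≠ 0 → IsUnit z

/-- `exp(A) = 4`: the Brauer class of `A` has order `4`, i.e. `A ⊗ A` is not split but
`A⊗A⊗A⊗A` is split (the order of the class then divides `4` and is not `1` or `2`). -/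
def HasExpFour (K : Type u) (A : Type u) [Field K] [Ring A] [Algebra K A] : Prop :=
  ¬ IsSplitAlg K (A ⊗[K] A) ∧ IsSplitAlg K ((A ⊗[K] A) ⊗[K] (A ⊗[K] A))

/-- The split (hyperbolic) quadratic form `m × H`, where `H(x, y) = xy` is the hyperbolic
plane. -/
def hypForm (K : Type u) [Field K] (m : ℕ) : QuadraticForm K ((Fin m × Fin 2) → K) :=
  Matrix.toQuadraticMap'
    (fun p q => if p.1 = q.1 ∧ p.2 = 0 ∧ q.2 = 1 then (1 : K) else 0)

/-- Witt equivalence of quadratic forms (equality in the Witt group `W_q(K)`): the two forms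
become isometric after adding split (hyperbolic) forms. -/
def WittEquiv {K : Type u} [Field K] {M N : Type u} [AddCommGroup M] [Module K M]
    [AddCommGroup N] [Module K N] (φ : QuadraticForm K M) (ψ : QuadraticForm K N) : Prop :=
  ∃ m k : ℕ, QuadraticMap.Equivalent (φ.prod (hypForm K m)) (ψ.prod (hypForm K k))

/-- The binary quadratic form `[1,1] : (x, y) ↦ x² + xy + y²`. -/
def formOneOne (K : Type u) [Field K] : QuadraticForm K (Fin 2 → K) :=
  Matrix.toQuadraticMap' !![1, 1; 0, 1]

theorem exists_common_zero {F : Type*} [Field F] [IsAlgClosed F] {σ ι : Type*} [Finite σ] [Fintype ι]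
    (f : ι → MvPolynomial σ F) (h0 : ∀ i, MvPolynomial.eval 0 (f i) = 0)
    (hcard : Fintype.card ι < Nat.card σ) :
    ∃ z : σ → F, z ≠ 0 ∧ ∀ i, MvPolynomial.eval z (f i) = 0 := by
  classical
  by_contra hcon
  push Not at hcon
  have hdim : ringKrullDim (MvPolynomial σ F) = Nat.card σ := by
    rw [MvPolynomial.ringKrullDim_of_isNoetherianRing]; simp
  have : FiniteRingKrullDim (MvPolynomial σ F) := by
    rw [finiteRingKrullDim_iff_ne_bot_and_top, hdim]
    refine ⟨by simp, ?_⟩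
    exact fun h => by simpa using (WithBot.coe_eq_coe.mp (h : ((Nat.card σ : ℕ∞) : WithBot ℕ∞) = _))
  obtain ⟨m, hm, hht⟩ := Ideal.exists_isMaximal_height (R := MvPolynomial σ F)
  obtain ⟨p, rfl⟩ := MvPolynomial.isMaximal_iff_eq_vanishingIdeal_singleton.mp hm
  let f' : ι → MvPolynomial σ F := fun i => MvPolynomial.bind₁ (fun j => MvPolynomial.X j - MvPolynomial.C (p j)) (f i)
  have hf' : ∀ i z, MvPolynomial.eval z (f' i) = MvPolynomial.eval (z - p) (f i) := by
    intro i z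
    simp only [f', MvPolynomial.eval, MvPolynomial.eval₂Hom_bind₁]
    congr 2
    ext j
    simp
  have hV : MvPolynomial.zeroLocus F (Ideal.span (Set.range f')) = {p} := by
    ext z
    rw [MvPolynomial.zeroLocus_span]
    simp only [Set.mem_ofPred_eq, Set.mem_singleton_iff, Set.forall_mem_range]
    constructor
    · intro h
      by_contra hne
      obtain ⟨i, hi⟩ := hcon (z - p) (sub_ne_zero.mpr hne)
      apply hi
      rw [← hf']
      simpa [MvPolynomial.aeval_eq_eval] using h i
    · rintro rfl i
      have := hf' i z
      simp only [sub_self, h0] at this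
      simpa [MvPolynomial.aeval_eq_eval] using this
  have hrad := MvPolynomial.vanishingIdeal_zeroLocus_eq_radical (k := F) (K := F) (Ideal.span (Set.range f'))
  rw [hV] at hrad
  have hmin : MvPolynomial.vanishingIdeal F {p} ∈ (Ideal.span (Set.range f')).minimalPrimes := by
    rw [← Ideal.radical_minimalPrimes, ← hrad]
    have := hm.isPrime
    rw [Ideal.minimalPrimes_eq_subsingleton_self]; rfl
  have h1 := Ideal.height_le_card_of_mem_minimalPrimes_span (Set.finite_range f') hmin
  rw [hdim] at hht
  have h2 : ((Set.range f').ncard : ℕ∞) ≤ Fintype.card ι := by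
    rw [← Set.image_univ]
    refine Nat.cast_le.mpr ((Set.ncard_image_le Set.finite_univ).trans ?_)
    simp [Set.ncard_univ]
  have h3 : ((Nat.card σ : ℕ∞)) ≤ Fintype.card ι := by
    have : (MvPolynomial.vanishingIdeal F {p}).height = (Nat.card σ : ℕ∞) := by
      exact_mod_cast hht
    rw [← this]
    exact h1.trans h2
  have : Nat.card σ ≤ Fintype.card ι := by exact_mod_cast h3
  omega

open MvPolynomial in
theorem poly_isotropic {F : Type*} [Field F] [IsAlgClosed F]
    (n : Fin 5 → Fin 5 → MvPolynomial (Fin 2) F) :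
    ∃ p : Fin 5 → MvPolynomial (Fin 2) F, p ≠ 0 ∧ ∑ i, ∑ j, n i j * p i * p j = 0 := by
  classical
  obtain ⟨E, hE⟩ : ∃ E : ℕ, ∀ i j k, degreeOf k (n i j) ≤ E := by
    refine ⟨∑ i, ∑ j, ∑ k, degreeOf k (n i j), fun i j k => ?_⟩
    refine le_trans ?_ (Finset.single_le_sum (f := fun i => ∑ j, ∑ k, degreeOf k (n i j)) (fun _ _ => Nat.zero_le _) (Finset.mem_univ i))
    refine le_trans ?_ (Finset.single_le_sum (f := fun j => ∑ k, degreeOf k (n i j)) (fun _ _ => Nat.zero_le _) (Finset.mem_univ j))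
    exact (Finset.single_le_sum (f := fun k => degreeOf k (n i j)) (fun _ _ => Nat.zero_le _) (Finset.mem_univ k))
  let N := 10 * E + 10
  let ex : ∀ M : ℕ, (Fin 2 → Fin M) → (Fin 2 →₀ ℕ) := fun M s => Finsupp.equivFunOnFinite.symm (fun i => (s i : ℕ))
  have hexinj : ∀ M, Function.Injective (ex M) := by
    intro M s s' h
    have := Finsupp.equivFunOnFinite.symm.injective h
    funext i
    exact Fin.ext (congrFun this i)
  let σ := Fin 5 × (Fin 2 → Fin (N + 1))
  let ι := Fin 2 → Fin (2 * N + E + 1)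
  let f : ι → MvPolynomial σ F := fun e => ∑ i, ∑ j, ∑ a, ∑ b,
    C (coeff (ex _ e) (n i j * monomial (ex _ a) 1 * monomial (ex _ b) 1)) * X (i, a) * X (j, b)
  obtain ⟨z, hz, hzero⟩ := exists_common_zero f (by intro i; simp [f]) (by
    simp [ι, σ, N, Fintype.card_pi]
    nlinarith [Nat.zero_le (E ^ 2), Nat.zero_le E])
  let p : Fin 5 → MvPolynomial (Fin 2) F := fun i => ∑ a, C (z (i, a)) * monomial (ex (N+1) a) 1
  have hpc : ∀ i a, coeff (ex _ a) (p i) = z (i, a) := by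
    intro i a
    simp only [p, coeff_sum, coeff_C_mul, coeff_monomial]
    rw [Finset.sum_eq_single a]
    · simp
    · intro b _ hb
      rw [if_neg (fun h => hb (hexinj _ h)), mul_zero]
    · simp
  have hdeg : ∀ i k, degreeOf k (p i) ≤ N := by
    intro i k
    refine (degreeOf_sum_le k _ _).trans (Finset.sup_le fun a _ => ?_)
    refine (degreeOf_C_mul_le _ _ _).trans ?_
    rw [degreeOf_monomial_eq _ _ one_ne_zero]
    have := (a k).2
    simp only [ex, Finsupp.equivFunOnFinite_symm_apply_apply]
    omega
  refine ⟨p, ?_, ?_⟩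
  · intro h
    apply hz
    funext ⟨i, a⟩
    rw [← hpc, h]; simp
  · have hd2 : ∀ k, degreeOf k (∑ i, ∑ j, n i j * p i * p j) ≤ 2 * N + E := by
      intro k
      refine (degreeOf_sum_le k _ _).trans (Finset.sup_le fun i _ => ?_)
      refine (degreeOf_sum_le k _ _).trans (Finset.sup_le fun j _ => ?_)
      have h1 := degreeOf_mul_le k (n i j * p i) (p j)
      have h2 := degreeOf_mul_le k (n i j) (p i)
      have := hE i j k
      have := hdeg i k
      have := hdeg j k
      omega
    ext e
    rw [coeff_zero]
    by_contra hne
    have hlt : ∀ k, e k < 2 * N + E + 1 := by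
      intro k
      have := degreeOf_le_iff.mp (hd2 k) e (mem_support_iff.mpr hne)
      omega
    have h := hzero (fun k => ⟨e k, hlt k⟩)
    apply hne
    rw [← h]
    have he : ex (2 * N + E + 1) (fun k => ⟨e k, hlt k⟩) = e := by ext k; simp [ex]
    simp only [f, he, map_sum, map_mul, eval_C, eval_X, coeff_sum]
    refine Finset.sum_congr rfl fun i _ => Finset.sum_congr rfl fun j _ => ?_
    simp only [p, Finset.mul_sum, Finset.sum_mul, coeff_sum]
    rw [Finset.sum_comm]
    refine Finset.sum_congr rfl fun a _ => Finset.sum_congr rfl fun b _ => ?_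
    rw [show n i j * (C (z (i, a)) * (monomial (ex (N + 1) a)) 1) * (C (z (j, b)) * (monomial (ex (N + 1) b)) 1) =
      C (z (i,a) * z (j,b)) * (n i j * monomial (ex (N + 1) a) 1 * monomial (ex (N + 1) b) 1) by rw [C_mul]; ring, coeff_C_mul]
    ring

theorem frac_isotropic {F : Type*} [Field F] [IsAlgClosed F] {K : Type*} [Field K]
    [Algebra (MvPolynomial (Fin 2) F) K] [IsFractionRing (MvPolynomial (Fin 2) F) K]
    (m : Fin 5 → Fin 5 → K) :
    ∃ p : Fin 5 → K, p ≠ 0 ∧ ∑ i, ∑ j, m i j * p i * p j = 0 := by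
  obtain ⟨d, hd⟩ := IsLocalization.exist_integer_multiples_of_finite (nonZeroDivisors (MvPolynomial (Fin 2) F))
    (fun ij : Fin 5 × Fin 5 => m ij.1 ij.2)
  choose n hn using hd
  obtain ⟨p, hp, hp0⟩ := poly_isotropic (fun i j => n (i, j))
  have hinj := IsFractionRing.injective (MvPolynomial (Fin 2) F) K
  refine ⟨fun i => algebraMap _ K (p i), ?_, ?_⟩
  · intro h
    apply hp
    funext i
    apply hinj
    simpa using congrFun h i
  · have h := congrArg (algebraMap _ K) hp0
    simp only [map_sum, map_mul, map_zero, hn] at h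
    have hd0 : algebraMap _ K (d : MvPolynomial (Fin 2) F) ≠ 0 := by
      intro h0
      exact nonZeroDivisors.ne_zero d.2 (hinj (by simp [h0]))
    refine (mul_eq_zero.mp (?_ : algebraMap _ K (d : MvPolynomial (Fin 2) F) * _ = 0)).resolve_left hd0
    rw [← h]
    simp only [Finset.mul_sum]
    refine Finset.sum_congr rfl fun i _ => Finset.sum_congr rfl fun j _ => ?_
    rw [Algebra.smul_def]
    ring

open MvPolynomial in
theorem poly_anis {K : Type*} [Field K] (m : Fin 4 → Fin 4 → K)
    (hm : ∀ z : Fin 4 → K, ∑ i, ∑ j, m i j * z i * z j = 0 → z = 0)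
    (P : Fin 2 × Fin 2 → Fin 4 → MvPolynomial (Fin 2) K)
    (hP : ∑ a, monomial (Finsupp.single 0 (a.1 : ℕ) + Finsupp.single 1 (a.2 : ℕ)) 1 *
      ∑ i, ∑ j, C (m i j) * P a i * P a j = 0) : P = 0 := by
  classical
  by_contra hne
  let o : MonomialOrder (Fin 2) := MonomialOrder.lex
  let ee : Fin 2 × Fin 2 → (Fin 2 →₀ ℕ) := fun a => Finsupp.single 0 (a.1 : ℕ) + Finsupp.single 1 (a.2 : ℕ)
  let S : Finset ((Fin 2 × Fin 2) × Fin 4) := Finset.univ.filter fun ai => P ai.1 ai.2 ≠ 0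
  have hS : S.Nonempty := by
    by_contra hS
    rw [Finset.not_nonempty_iff_eq_empty] at hS
    apply hne
    funext a i
    by_contra h
    have : (a, i) ∈ S := by simpa [S] using h
    simp [hS] at this
  let wt : (Fin 2 × Fin 2) × Fin 4 → (Fin 2 →₀ ℕ) := fun ai => o.degree (P ai.1 ai.2) + o.degree (P ai.1 ai.2) + ee ai.1
  obtain ⟨⟨a, i0⟩, hmem, hmax⟩ := S.exists_max_image (fun ai => o.toSyn (wt ai)) hS
  have hai : P a i0 ≠ 0 := by simpa [S] using hmem
  set d := o.degree (P a i0) with hd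
  have hmax' : ∀ b i, P b i ≠ 0 → o.toSyn (wt (b, i)) ≤ o.toSyn (d + d + ee a) := by
    intro b i h
    exact hmax (b, i) (by simpa [S] using h)
  have hlt : ∀ b i, b ≠ a → P b i ≠ 0 → o.toSyn (wt (b, i)) < o.toSyn (d + d + ee a) := by
    intro b i hb h
    refine lt_of_le_of_ne (hmax' b i h) fun h' => hb ?_
    have h2 := o.toSyn.injective h'
    have h20 := DFunLike.congr_fun h2 0
    have h21 := DFunLike.congr_fun h2 1
    simp [wt, ee] at h20 h21
    have := b.1.2
    have := b.2.2
    have := a.1.2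
    have := a.2.2
    ext <;> omega
  have hc := congrArg (coeff (d + d + ee a)) hP
  rw [coeff_sum, Finset.sum_eq_single a, coeff_zero] at hc
  · rw [add_comm (d + d), coeff_monomial_mul, one_mul] at hc
    have hle : ∀ i, o.toSyn (o.degree (P a i)) ≤ o.toSyn d := by
      intro i
      by_cases h : P a i = 0
      · rw [h, o.degree_zero, map_zero]; exact bot_le
      have := hmax' a i h
      simp only [wt, map_add] at this
      have := le_of_add_le_add_right this
      by_contra hh
      rw [not_le] at hh
      exact absurd this (not_le.mpr (add_lt_add hh hh))
    have key : ∑ i, ∑ j, m i j * coeff d (P a i) * coeff d (P a j) = 0 := by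
      rw [← hc]
      simp only [coeff_sum]
      refine Finset.sum_congr rfl fun i _ => Finset.sum_congr rfl fun j _ => ?_
      rw [mul_assoc (C _), coeff_C_mul, o.coeff_mul_of_add_of_degree_le (hle i) (hle j), mul_assoc]
    have := congrFun (hm _ key) i0
    exact (o.leadingCoeff_ne_zero_iff.mpr hai) this
  · intro b _ hb
    simp only [Finset.mul_sum, coeff_sum]
    refine Finset.sum_eq_zero fun i _ => Finset.sum_eq_zero fun j _ => ?_
    by_cases hi : P b i = 0
    · simp [hi]
    by_cases hj : P b j = 0
    · simp [hj]
    apply o.coeff_eq_zero_of_lt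
    have h1 := hlt b i hb hi
    have h2 := hlt b j hb hj
    have h3 : o.toSyn (o.degree (P b i) + o.degree (P b j) + ee b) < o.toSyn (d + d + ee a) := by
      simp only [wt, map_add] at h1 h2 ⊢
      rcases le_total (o.toSyn (o.degree (P b i))) (o.toSyn (o.degree (P b j))) with h | h
      · refine lt_of_le_of_lt ?_ h2
        gcongr
      · refine lt_of_le_of_lt ?_ h1
        gcongr
    refine lt_of_le_of_lt ?_ h3
    refine o.degree_mul_le.trans ?_
    rw [map_add, map_add _ _ (ee b), add_comm]
    gcongr
    · refine o.degree_mul_le.trans ?_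
      rw [map_add, map_add]
      gcongr
      refine o.degree_mul_le.trans ?_
      simp
    · exact o.degree_monomial_le _
  · simp

open MvPolynomial in
theorem frac_anis {K : Type*} [Field K] (m : Fin 4 → Fin 4 → K)
    (hm : ∀ z : Fin 4 → K, ∑ i, ∑ j, m i j * z i * z j = 0 → z = 0)
    {K2 : Type*} [Field K2] [Algebra (MvPolynomial (Fin 2) K) K2]
    [IsFractionRing (MvPolynomial (Fin 2) K) K2] [Algebra K K2]
    [IsScalarTower K (MvPolynomial (Fin 2) K) K2]
    (s t : K2) (hs : s = algebraMap (MvPolynomial (Fin 2) K) K2 (MvPolynomial.X 0))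
    (ht : t = algebraMap (MvPolynomial (Fin 2) K) K2 (MvPolynomial.X 1))
    (Z : Fin 2 × Fin 2 → Fin 4 → K2)
    (hZ : ∑ a, s ^ (a.1 : ℕ) * t ^ (a.2 : ℕ) *
      ∑ i, ∑ j, algebraMap K K2 (m i j) * Z a i * Z a j = 0) : Z = 0 := by
  obtain ⟨d, hd⟩ := IsLocalization.exist_integer_multiples_of_finite (nonZeroDivisors (MvPolynomial (Fin 2) K))
    (fun ij : (Fin 2 × Fin 2) × Fin 4 => Z ij.1 ij.2)
  choose n hn using hd
  have hinj := IsFractionRing.injective (MvPolynomial (Fin 2) K) K2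
  have hd0 : algebraMap _ K2 (d : MvPolynomial (Fin 2) K) ≠ 0 := by
    intro h0
    exact nonZeroDivisors.ne_zero d.2 (hinj (by simp [h0]))
  have := poly_anis m hm (fun a i => n (a, i)) (by
    apply hinj
    rw [map_zero]
    rw [show (0 : K2) = (algebraMap _ K2 (d : MvPolynomial (Fin 2) K)) ^ 2 * 0 by simp, ← hZ]
    simp only [map_sum, map_mul, hn, Finset.mul_sum]
    refine Finset.sum_congr rfl fun a _ => Finset.sum_congr rfl fun i _ => Finset.sum_congr rfl fun j _ => ?_
    have h1 : algebraMap (MvPolynomial (Fin 2) K) K2 (C (m i j)) = algebraMap K K2 (m i j) := by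
      rw [IsScalarTower.algebraMap_apply K (MvPolynomial (Fin 2) K) K2]; rfl
    have h2 : algebraMap (MvPolynomial (Fin 2) K) K2 (monomial (Finsupp.single 0 (a.1 : ℕ) + Finsupp.single 1 (a.2 : ℕ)) 1)
       = s ^ (a.1 : ℕ) * t ^ (a.2 : ℕ) := by
      rw [hs, ht, ← map_pow, ← map_pow, ← map_mul, X_pow_eq_monomial, X_pow_eq_monomial, monomial_mul, one_mul]
    rw [h1, h2, Algebra.smul_def, Algebra.smul_def]
    ring)
  funext a i
  have h := congrFun (congrFun this a) i
  have h' := hn (a, i)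
  simp only [Pi.zero_apply] at h
  rw [h, map_zero, Algebra.smul_def] at h'
  exact (mul_eq_zero.mp h'.symm).resolve_left hd0

theorem no_as {F : Type*} [Field F] {K : Type*} [Field K]
    [Algebra (MvPolynomial (Fin 2) F) K] [IsFractionRing (MvPolynomial (Fin 2) F) K]
    (i : Fin 2) (g : K) : g ^ 2 + g ≠ algebraMap _ K (MvPolynomial.X i : MvPolynomial (Fin 2) F) := by
  intro h
  obtain ⟨p, q, hq, rfl⟩ := IsFractionRing.div_surjective (A := MvPolynomial (Fin 2) F) g
  have hinj := IsFractionRing.injective (MvPolynomial (Fin 2) F) K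
  have hq0 : q ≠ 0 := nonZeroDivisors.ne_zero hq
  have hq1 : algebraMap _ K q ≠ 0 := fun h0 => hq0 (hinj (by simp [h0]))
  have h1 : p ^ 2 + p * q = MvPolynomial.X i * q ^ 2 := by
    apply hinj
    simp only [map_add, map_mul, map_pow, ← h]
    field_simp
  have hX : (MvPolynomial.X i : MvPolynomial (Fin 2) F) ≠ 0 := MvPolynomial.X_ne_zero i
  have hr : (MvPolynomial.X i * q ^ 2 : MvPolynomial (Fin 2) F).totalDegree = 1 + 2 * q.totalDegree := by
    rw [MvPolynomial.totalDegree_mul_of_isDomain hX (pow_ne_zero 2 hq0), MvPolynomial.totalDegree_X, pow_two,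
      MvPolynomial.totalDegree_mul_of_isDomain hq0 hq0]
    ring
  have hp0 : p ≠ 0 := by
    rintro rfl
    simp [hq0] at h1
  have e1 : (p ^ 2).totalDegree = 2 * p.totalDegree := by
    rw [pow_two, MvPolynomial.totalDegree_mul_of_isDomain hp0 hp0]; ring
  have e2 : (p * q).totalDegree = p.totalDegree + q.totalDegree :=
    MvPolynomial.totalDegree_mul_of_isDomain hp0 hq0
  rw [← h1] at hr
  rcases lt_or_ge q.totalDegree p.totalDegree with hlt | hge
  · rw [MvPolynomial.totalDegree_add_eq_left_of_totalDegree_lt (by omega)] at hr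
    omega
  · have := MvPolynomial.totalDegree_add (p ^ 2) (p * q)
    rw [e1, e2, hr] at this
    rcases le_max_iff.mp this with h | h <;> omega

def cpGen {k : Type u} [Field k] {a b u0 u1 v0 v1 w0 w1 : k} (i : Fin 4) :
    CrossedProd k a b u0 u1 v0 v1 w0 w1 :=
  RingQuot.mkAlgHom k (CrossedRel k a b u0 u1 v0 v1 w0 w1) (FreeAlgebra.ι k i)

structure CPRel (k : Type*) [Field k] (B : Type*) [Ring B] [Algebra k B]
    (a b u0 u1 v0 v1 w0 w1 : k) (al be la de : B) : Prop where
  aa : al * al + al = algebraMap k B a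
  bb : be * be + be = algebraMap k B b
  ab : al * be = be * al
  la_al : la * al = al * la
  la_be : la * be = be * la + la
  de_be : de * be = be * de
  de_al : de * al = al * de + de
  ll : la * la = algebraMap k B u0 + algebraMap k B u1 * al
  dd : de * de = algebraMap k B v0 + algebraMap k B v1 * be
  ww : la * de * (la * de) = algebraMap k B w0 + algebraMap k B w1 * (al + be)

theorem cp_rel {k : Type u} [Field k] {a b u0 u1 v0 v1 w0 w1 : k} :
    CPRel k (CrossedProd k a b u0 u1 v0 v1 w0 w1) a b u0 u1 v0 v1 w0 w1
      (cpGen 0) (cpGen 1) (cpGen 2) (cpGen 3) := by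
  have h := fun p q (h : CrossedRel k a b u0 u1 v0 v1 w0 w1 p q) => RingQuot.mkAlgHom_rel k h
  have hc := fun r : k => (RingQuot.mkAlgHom k (CrossedRel k a b u0 u1 v0 v1 w0 w1)).commutes r
  constructor
  · have := h _ _ CrossedRel.alpha_sq
    rw [hc, map_add, map_mul] at this; exact this
  · have := h _ _ CrossedRel.beta_sq
    rw [hc, map_add, map_mul] at this; exact this
  · have := h _ _ CrossedRel.alpha_beta
    rw [map_mul, map_mul] at this; exact this
  · have := h _ _ CrossedRel.lambda_alpha
    rw [map_mul, map_mul] at this; exact this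
  · have := h _ _ CrossedRel.lambda_beta
    rw [map_mul, map_add, map_mul] at this; exact this
  · have := h _ _ CrossedRel.delta_beta
    rw [map_mul, map_mul] at this; exact this
  · have := h _ _ CrossedRel.delta_alpha
    rw [map_mul, map_add, map_mul] at this; exact this
  · have := h _ _ CrossedRel.lambda_sq
    rw [map_mul, map_add, map_mul, hc, hc] at this; exact this
  · have := h _ _ CrossedRel.delta_sq
    rw [map_mul, map_add, map_mul, hc, hc] at this; exact this
  · have := h _ _ CrossedRel.lambda_delta_sq
    rw [map_mul, map_mul, map_add, map_mul, map_add, hc, hc] at this; exact this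

theorem cp_lift {k : Type u} [Field k] {a b u0 u1 v0 v1 w0 w1 : k}
    {B : Type*} [Ring B] [Algebra k B] {al be la de : B}
    (h : CPRel k B a b u0 u1 v0 v1 w0 w1 al be la de) :
    ∃ f : CrossedProd k a b u0 u1 v0 v1 w0 w1 →ₐ[k] B,
      f (cpGen 0) = al ∧ f (cpGen 1) = be ∧ f (cpGen 2) = la ∧ f (cpGen 3) = de := by
  let f0 : FreeAlgebra k (Fin 4) →ₐ[k] B := FreeAlgebra.lift k ![al, be, la, de]
  have hf : ∀ i, f0 (FreeAlgebra.ι k i) = (![al, be, la, de] : Fin 4 → B) i := by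
    intro i; simp [f0]
  have hf0 := hf 0
  have hf1 := hf 1
  have hf2 := hf 2
  have hf3 := hf 3
  simp only [Matrix.cons_val] at hf0 hf1 hf2 hf3
  have hw : ∀ ⦃p q⦄, CrossedRel k a b u0 u1 v0 v1 w0 w1 p q → f0 p = f0 q := by
    intro p q hpq
    cases hpq <;> simp only [map_add, map_mul, hf0, hf1, hf2, hf3, AlgHom.commutes]
    · exact h.aa
    · exact h.bb
    · exact h.ab
    · exact h.la_al
    · exact h.la_be
    · exact h.de_be
    · exact h.de_al
    · exact h.ll
    · exact h.dd
    · exact h.ww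
  refine ⟨(RingQuot.liftAlgHom k ⟨f0, hw⟩ :), ?_, ?_, ?_, ?_⟩
  · exact (RingQuot.liftAlgHom_mkAlgHom_apply k f0 hw _).trans hf0
  · exact (RingQuot.liftAlgHom_mkAlgHom_apply k f0 hw _).trans hf1
  · exact (RingQuot.liftAlgHom_mkAlgHom_apply k f0 hw _).trans hf2
  · exact (RingQuot.liftAlgHom_mkAlgHom_apply k f0 hw _).trans hf3

theorem cp_central {k : Type u} [Field k] {a b u0 u1 v0 v1 w0 w1 : k}
    (z : CrossedProd k a b u0 u1 v0 v1 w0 w1) (hz : ∀ i, cpGen i * z = z * cpGen i) :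
    z ∈ Subalgebra.center k (CrossedProd k a b u0 u1 v0 v1 w0 w1) := by
  rw [Subalgebra.mem_center_iff]
  intro bz
  let mk : FreeAlgebra k (Fin 4) →ₐ[k] CrossedProd k a b u0 u1 v0 v1 w0 w1 :=
    RingQuot.mkAlgHom k (CrossedRel k a b u0 u1 v0 v1 w0 w1)
  obtain ⟨p, hp⟩ : ∃ p, mk p = bz :=
    RingQuot.mkAlgHom_surjective k (CrossedRel k a b u0 u1 v0 v1 w0 w1) bz
  rw [← hp]
  clear hp
  induction p using FreeAlgebra.induction with
  | grade0 r =>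
    rw [AlgHom.commutes]
    exact Algebra.commutes r z
  | grade1 i => exact hz i
  | mul p q hp hq => rw [map_mul, mul_assoc, hq, ← mul_assoc, hp, mul_assoc]
  | add p q hp hq => rw [map_add, add_mul, mul_add, hp, hq]

theorem mat4_charpoly_coeff {R : Type*} [CommRing R] (M : Matrix (Fin 4) (Fin 4) R) :
    M.charpoly.coeff 2 = (M 0 0 * M 1 1 - M 0 1 * M 1 0) + (M 0 0 * M 2 2 - M 0 2 * M 2 0)
      + (M 0 0 * M 3 3 - M 0 3 * M 3 0) + (M 1 1 * M 2 2 - M 1 2 * M 2 1)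
      + (M 1 1 * M 3 3 - M 1 3 * M 3 1) + (M 2 2 * M 3 3 - M 2 3 * M 3 2) := by
  have key : ∃ e3 e4 : R, M.charpoly = Polynomial.X ^ 4 -
      Polynomial.C (M 0 0 + M 1 1 + M 2 2 + M 3 3) * Polynomial.X ^ 3 +
      Polynomial.C ((M 0 0 * M 1 1 - M 0 1 * M 1 0) + (M 0 0 * M 2 2 - M 0 2 * M 2 0)
      + (M 0 0 * M 3 3 - M 0 3 * M 3 0) + (M 1 1 * M 2 2 - M 1 2 * M 2 1)
      + (M 1 1 * M 3 3 - M 1 3 * M 3 1) + (M 2 2 * M 3 3 - M 2 3 * M 3 2)) * Polynomial.X ^ 2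
      - Polynomial.C e3 * Polynomial.X + Polynomial.C e4 := by
    let f : Fin 4 → Matrix (Fin 3) (Fin 3) R := fun i => M.submatrix i.succAbove i.succAbove
    refine ⟨(f 0).det + (f 1).det + (f 2).det + (f 3).det, M.det, ?_⟩
    rw [Matrix.charpoly, Matrix.det_succ_row_zero, Matrix.det_succ_row_zero M]
    simp only [Fin.sum_univ_four, Matrix.det_fin_three, f]
    simp [Matrix.charmatrix, Fin.succAbove, Matrix.submatrix]
    ring
  obtain ⟨e3, e4, h⟩ := key
  rw [h]
  simp only [Polynomial.coeff_add, Polynomial.coeff_sub, Polynomial.coeff_C_mul,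
    Polynomial.coeff_X_pow, Polynomial.coeff_X, Polynomial.coeff_C]
  simp

open Matrix Kronecker in
theorem charpoly_mulLeft_matrix {R : Type*} [Field R] {n : ℕ} (M : Matrix (Fin n) (Fin n) R) :
    (LinearMap.mulLeft R M).charpoly = M.charpoly ^ n := by
  rw [← LinearMap.charpoly_toMatrix _ (Matrix.stdBasis R (Fin n) (Fin n))]
  have h1 : LinearMap.toMatrix (Matrix.stdBasis R (Fin n) (Fin n)) (Matrix.stdBasis R (Fin n) (Fin n))
      (LinearMap.mulLeft R M) = M ⊗ₖ (1 : Matrix (Fin n) (Fin n) R) := by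
    ext ⟨i, j⟩ ⟨i', j'⟩
    rw [LinearMap.toMatrix_apply]
    rw [Matrix.stdBasis_eq_single, LinearMap.mulLeft_apply, Matrix.kroneckerMap_apply]
    have h0 : ∀ N : Matrix (Fin n) (Fin n) R, (Matrix.stdBasis R (Fin n) (Fin n)).repr N (i, j) = N i j := by
      intro N
      simp [Matrix.stdBasis]
    rw [h0, Matrix.mul_apply]
    by_cases hj : j = j'
    · subst hj
      simp [Matrix.single_apply]
    · simp [Matrix.single_apply, hj, Ne.symm hj]
  rw [h1]
  have h2 : charmatrix (M ⊗ₖ (1 : Matrix (Fin n) (Fin n) R)) = charmatrix M ⊗ₖ (1 : Matrix (Fin n) (Fin n) (Polynomial R)) := by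
    ext ⟨i, j⟩ ⟨i', j'⟩ : 2
    simp only [charmatrix_apply, Matrix.kroneckerMap_apply, Matrix.one_apply, Matrix.diagonal_apply, Prod.mk.injEq]
    split_ifs <;> simp_all
  rw [Matrix.charpoly, h2, Matrix.det_kronecker]
  simp [Matrix.charpoly]

theorem pow_four_inj {R : Type*} [Field R] [CharP R 2] (p q : Polynomial R) (h : p ^ 4 = q ^ 4) : p = q := by
  have := frobenius_inj (Polynomial R) 2
  have h1 : frobenius (Polynomial R) 2 (frobenius (Polynomial R) 2 p) = frobenius (Polynomial R) 2 (frobenius (Polynomial R) 2 q) := by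
    simp only [frobenius_def, ← pow_mul]; exact h
  exact this (this h1)

theorem charpoly_rep {k Ω A : Type*} [Field k] [Field Ω] [CharP Ω 2] [Algebra k Ω] [Ring A] [Algebra k A]
    {ι : Type*} [Fintype ι] [DecidableEq ι] [Module.Finite k A] (ρ : A →ₐ[k] Matrix (Fin 4) (Fin 4) Ω)
    (bA : Module.Basis ι k A) (bM : Module.Basis ι Ω (Matrix (Fin 4) (Fin 4) Ω))
    (hb : ∀ i, ρ (bA i) = bM i) (q : A) (p : Polynomial k)
    (hp : p ^ 4 = (LinearMap.mulLeft k q).charpoly) :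
    algebraMap k Ω (p.coeff 2) = (ρ q).charpoly.coeff 2 := by
  have hrep : ∀ z i, algebraMap k Ω (bA.repr z i) = bM.repr (ρ z) i := by
    intro z i
    have h1 : ρ z = ∑ i, algebraMap k Ω (bA.repr z i) • bM i := by
      conv_lhs => rw [← bA.sum_repr z]
      rw [map_sum]
      refine Finset.sum_congr rfl fun j _ => ?_
      rw [map_smul, hb, algebraMap_smul]
    rw [h1, bM.repr_sum_self]
  have h2 : (LinearMap.toMatrix bA bA (LinearMap.mulLeft k q)).map (algebraMap k Ω)
      = LinearMap.toMatrix bM bM (LinearMap.mulLeft Ω (ρ q)) := by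
    ext i j
    rw [Matrix.map_apply, LinearMap.toMatrix_apply, LinearMap.toMatrix_apply, hrep,
      LinearMap.mulLeft_apply, LinearMap.mulLeft_apply, map_mul, hb]
  have h3 : (p.map (algebraMap k Ω)) ^ 4 = (ρ q).charpoly ^ 4 := by
    rw [← charpoly_mulLeft_matrix, ← LinearMap.charpoly_toMatrix _ bM, ← h2, Matrix.charpoly_map,
      LinearMap.charpoly_toMatrix, ← hp, Polynomial.map_pow]
  rw [← pow_four_inj _ _ h3, Polynomial.coeff_map]

def cpMon {B : Type*} [Ring B] (al be la de : B) (p : Fin 4 × Fin 4) : B :=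
  (![1, al, be, al * be] : Fin 4 → B) p.1 * (![1, la, de, la * de] : Fin 4 → B) p.2

theorem cpMon_map {B C : Type*} [Ring B] [Ring C] (f : B →+* C) (al be la de : B) (p : Fin 4 × Fin 4) :
    f (cpMon al be la de p) = cpMon (f al) (f be) (f la) (f de) p := by
  obtain ⟨i, j⟩ := p
  fin_cases i <;> fin_cases j <;> simp [cpMon]

def lf {Ω : Type*} [Field Ω] (c : Fin 4 × Fin 4 → Ω) (g : Fin 4) (α β : Ω) : Ω :=
  c (0, g) + c (1, g) * α + c (2, g) * β + c (3, g) * (α * β)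

def mAl {Ω : Type*} [Field Ω] (α : Ω) : Matrix (Fin 4) (Fin 4) Ω :=
  !![α, 0, 0, 0; 0, α, 0, 0; 0, 0, α + 1, 0; 0, 0, 0, α + 1]
def mBe {Ω : Type*} [Field Ω] (β : Ω) : Matrix (Fin 4) (Fin 4) Ω :=
  !![β, 0, 0, 0; 0, β + 1, 0, 0; 0, 0, β, 0; 0, 0, 0, β + 1]
def mLa {Ω : Type*} [Field Ω] (U U' : Ω) : Matrix (Fin 4) (Fin 4) Ω :=
  !![0, U, 0, 0; 1, 0, 0, 0; 0, 0, 0, U'; 0, 0, 1, 0]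
def mDe {Ω : Type*} [Field Ω] (V n m : Ω) : Matrix (Fin 4) (Fin 4) Ω :=
  !![0, 0, V, 0; 0, 0, 0, n; 1, 0, 0, 0; 0, m, 0, 0]

theorem cpMon_sum {Ω : Type*} [Field Ω] (c : Fin 4 × Fin 4 → Ω) (α β U U' V n m : Ω) :
    ∑ p, c p • cpMon (mAl α) (mBe β) (mLa U U') (mDe V n m) p =
    !![lf c 0 α β, lf c 1 α β * U, lf c 2 α β * V, lf c 3 α β * (U * n);
       lf c 1 α (β + 1), lf c 0 α (β + 1), lf c 3 α (β + 1) * V, lf c 2 α (β + 1) * n;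
       lf c 2 (α + 1) β, lf c 3 (α + 1) β * (U' * m), lf c 0 (α + 1) β, lf c 1 (α + 1) β * U';
       lf c 3 (α + 1) (β + 1), lf c 2 (α + 1) (β + 1) * m, lf c 1 (α + 1) (β + 1), lf c 0 (α + 1) (β + 1)] := by
  rw [Fintype.sum_prod_type_right]
  simp only [Fin.sum_univ_four, cpMon, lf]
  ext i j
  simp only [Matrix.cons_val, Matrix.add_apply, Matrix.smul_apply, Matrix.mul_apply, Fin.sum_univ_four,
    one_mul, mul_one, smul_eq_mul]
  fin_cases i <;> fin_cases j <;> simp [mAl, mBe, mLa, mDe, Matrix.one_apply] <;> ring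

theorem lf_zero {Ω : Type*} [Field Ω] (c : Fin 4 × Fin 4 → Ω) (g : Fin 4) (α β : Ω)
    (h0 : lf c g α β = 0) (h1 : lf c g α (β + 1) = 0) (h2 : lf c g (α + 1) β = 0)
    (h3 : lf c g (α + 1) (β + 1) = 0) : ∀ i, c (i, g) = 0 := by
  unfold lf at *
  have e3 : c (3, g) = 0 := by linear_combination h0 - h1 - h2 + h3
  have e2 : c (2, g) = 0 := by linear_combination h1 - h0 - α * e3
  have e1 : c (1, g) = 0 := by linear_combination h2 - h0 - β * e3
  have e0 : c (0, g) = 0 := by linear_combination h0 - α * e1 - β * e2 - α * β * e3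
  intro i; fin_cases i <;> assumption

theorem cpMon_indep {Ω : Type*} [Field Ω] (α β U U' V n m : Ω) (hU : U ≠ 0) (hU' : U' ≠ 0) (hV : V ≠ 0)
    (hn : n ≠ 0) (hm : m ≠ 0) :
    LinearIndependent Ω (cpMon (mAl α) (mBe β) (mLa U U') (mDe V n m)) := by
  rw [Fintype.linearIndependent_iff]
  intro c hc
  rw [cpMon_sum] at hc
  have h := fun i j => congrFun (congrFun hc i) j
  have g0 := lf_zero c 0 α β (by simpa using h 0 0) (by simpa using h 1 1) (by simpa using h 2 2)
    (by simpa using h 3 3)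
  have g1 := lf_zero c 1 α β (by simpa [hU] using h 0 1) (by simpa using h 1 0)
    (by simpa [hU'] using h 2 3) (by simpa using h 3 2)
  have g2 := lf_zero c 2 α β (by simpa [hV] using h 0 2) (by simpa [hn] using h 1 3)
    (by simpa using h 2 0) (by simpa [hm] using h 3 1)
  have g3 := lf_zero c 3 α β (by simpa [hU, hn] using h 0 3) (by simpa [hV] using h 1 2)
    (by simpa [hU', hm] using h 2 1) (by simpa using h 3 0)
  rintro ⟨i, j⟩
  fin_cases j
  exacts [g0 i, g1 i, g2 i, g3 i]

set_option maxHeartbeats 2000000 in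
theorem mat_rel {k Ω : Type*} [Field k] [Field Ω] [CharP Ω 2] [Algebra k Ω] (a b u0 u1 v0 v1 w0 w1 : k)
    (α β n m : Ω) (hα : α * α + α = algebraMap k Ω a) (hβ : β * β + β = algebraMap k Ω b)
    (hW : (algebraMap k Ω u0 + algebraMap k Ω u1 * α) * n = algebraMap k Ω w0 + algebraMap k Ω w1 * (α + β))
    (hnm : n * m = algebraMap k Ω v0 + algebraMap k Ω v1 * (β + 1))
    (hW' : (algebraMap k Ω v0 + algebraMap k Ω v1 * β) *
      ((algebraMap k Ω u0 + algebraMap k Ω u1 * (α + 1)) * m)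
      = algebraMap k Ω w0 + algebraMap k Ω w1 * (α + β + 1)) :
    CPRel k (Matrix (Fin 4) (Fin 4) Ω) a b u0 u1 v0 v1 w0 w1 (mAl α) (mBe β)
      (mLa (algebraMap k Ω u0 + algebraMap k Ω u1 * α) (algebraMap k Ω u0 + algebraMap k Ω u1 * (α + 1)))
      (mDe (algebraMap k Ω v0 + algebraMap k Ω v1 * β) n m) := by
  have h2 : (2 : Ω) = 0 := CharTwo.two_eq_zero
  constructor
  all_goals
    ext i j
    simp only [Matrix.algebraMap_eq_diagonal, Matrix.add_apply, Matrix.mul_apply, Fin.sum_univ_four, Matrix.diagonal_apply]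
    fin_cases i <;> fin_cases j <;> simp [mAl, mBe, mLa, mDe]
  all_goals first
    | ring1
    | linear_combination hα
    | linear_combination hα + (α + 1) * h2
    | linear_combination hβ
    | linear_combination hβ + (β + 1) * h2
    | linear_combination -h2
    | linear_combination -m * h2
    | linear_combination hnm
    | linear_combination hW
    | linear_combination hW'
    | linear_combination hW - algebraMap k Ω w1 * h2

theorem cp_rep {k Ω : Type u} [Field k] [CharP k 2] [Field Ω] [IsAlgClosed Ω] [CharP Ω 2] [Algebra k Ω]
    (a b u0 u1 v0 v1 w0 w1 : k)
    (hnorm : (u0 ^ 2 + u0 * u1 + a * u1 ^ 2) * (v0 ^ 2 + v0 * v1 + b * v1 ^ 2) =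
      w0 ^ 2 + w0 * w1 + (a + b) * w1 ^ 2)
    (hu : u0 ^ 2 + u0 * u1 + a * u1 ^ 2 ≠ 0) (hv : v0 ^ 2 + v0 * v1 + b * v1 ^ 2 ≠ 0) :
    ∃ (ρ : CrossedProd k a b u0 u1 v0 v1 w0 w1 →ₐ[k] Matrix (Fin 4) (Fin 4) Ω) (α β n m : Ω),
      α * α + α = algebraMap k Ω a ∧ β * β + β = algebraMap k Ω b ∧
      (algebraMap k Ω u0 + algebraMap k Ω u1 * α) * n = algebraMap k Ω w0 + algebraMap k Ω w1 * (α + β) ∧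
      n * m = algebraMap k Ω v0 + algebraMap k Ω v1 * (β + 1) ∧
      (algebraMap k Ω v0 + algebraMap k Ω v1 * β) *
        ((algebraMap k Ω u0 + algebraMap k Ω u1 * (α + 1)) * m)
        = algebraMap k Ω w0 + algebraMap k Ω w1 * (α + β + 1) ∧
      LinearIndependent Ω (cpMon (mAl α) (mBe β)
      (mLa (algebraMap k Ω u0 + algebraMap k Ω u1 * α) (algebraMap k Ω u0 + algebraMap k Ω u1 * (α + 1)))
      (mDe (algebraMap k Ω v0 + algebraMap k Ω v1 * β) n m)) ∧
      ∀ p, ρ (cpMon (cpGen 0) (cpGen 1) (cpGen 2) (cpGen 3) p) = cpMon (mAl α) (mBe β)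
      (mLa (algebraMap k Ω u0 + algebraMap k Ω u1 * α) (algebraMap k Ω u0 + algebraMap k Ω u1 * (α + 1)))
      (mDe (algebraMap k Ω v0 + algebraMap k Ω v1 * β) n m) p := by
  have h2 : (2 : Ω) = 0 := CharTwo.two_eq_zero
  have as : ∀ r : Ω, ∃ z : Ω, z * z + z = r := by
    intro r
    obtain ⟨z, hz⟩ := IsAlgClosed.exists_root (Polynomial.X ^ 2 + Polynomial.X - Polynomial.C r)
      (by
        have : (Polynomial.X ^ 2 + Polynomial.X - Polynomial.C r : Polynomial Ω).degree = 2 := by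
          compute_degree!
        rw [this]; norm_num)
    refine ⟨z, ?_⟩
    simp [Polynomial.IsRoot] at hz
    linear_combination hz
  obtain ⟨α, hα⟩ := as (algebraMap k Ω a)
  obtain ⟨β, hβ⟩ := as (algebraMap k Ω b)
  have inj := (algebraMap k Ω).injective
  have hu' : algebraMap k Ω (u0 ^ 2 + u0 * u1 + a * u1 ^ 2) ≠ 0 := by
    rwa [Ne, map_eq_zero]
  have hv' : algebraMap k Ω (v0 ^ 2 + v0 * v1 + b * v1 ^ 2) ≠ 0 := by
    rwa [Ne, map_eq_zero]
  have hN := congrArg (algebraMap k Ω) hnorm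
  rw [map_mul] at hN
  simp only [map_add, map_mul, map_pow, ← hα, ← hβ] at hN hu' hv'
  set U0 := algebraMap k Ω u0
  set U1 := algebraMap k Ω u1
  set V0 := algebraMap k Ω v0
  set V1 := algebraMap k Ω v1
  set W0 := algebraMap k Ω w0
  set W1 := algebraMap k Ω w1
  have eu : U0 ^ 2 + U0 * U1 + (α * α + α) * U1 ^ 2 = (U0 + U1 * α) * (U0 + U1 * (α + 1)) := by
    linear_combination (-U0 * U1 * α) * h2
  have ev : V0 ^ 2 + V0 * V1 + (β * β + β) * V1 ^ 2 = (V0 + V1 * β) * (V0 + V1 * (β + 1)) := by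
    linear_combination (-V0 * V1 * β) * h2
  have ew : W0 ^ 2 + W0 * W1 + (α * α + α + (β * β + β)) * W1 ^ 2
      = (W0 + W1 * (α + β)) * (W0 + W1 * (α + β + 1)) := by
    linear_combination (-W0 * W1 * (α + β) - W1 ^ 2 * α * β) * h2
  rw [eu] at hu'
  rw [ev] at hv'
  rw [eu, ev, ew] at hN
  have hW0 : W0 + W1 * (α + β) ≠ 0 := by
    intro h; rw [h, zero_mul] at hN; exact mul_ne_zero hu' hv' hN
  obtain ⟨hU, hU'⟩ := mul_ne_zero_iff.1 hu'
  obtain ⟨hV, hV'⟩ := mul_ne_zero_iff.1 hv'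
  have e1 : (U0 + U1 * α) * ((W0 + W1 * (α + β)) / (U0 + U1 * α)) = W0 + W1 * (α + β) := by
    field_simp
  have e2 : (W0 + W1 * (α + β)) / (U0 + U1 * α) * ((U0 + U1 * α) * (V0 + V1 * (β + 1)) / (W0 + W1 * (α + β)))
      = V0 + V1 * (β + 1) := by
    rw [div_mul_div_comm, div_eq_iff (mul_ne_zero hU hW0)]
    ring
  have e3 : (V0 + V1 * β) * ((U0 + U1 * (α + 1)) * ((U0 + U1 * α) * (V0 + V1 * (β + 1)) / (W0 + W1 * (α + β))))
      = W0 + W1 * (α + β + 1) := by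
    field_simp
    linear_combination hN
  obtain ⟨ρ, r0, r1, r2, r3⟩ := cp_lift (mat_rel a b u0 u1 v0 v1 w0 w1 α β _ _ hα hβ e1 e2 e3)
  refine ⟨ρ, α, β, _, _, hα, hβ, e1, e2, e3, ?_, ?_⟩
  · exact cpMon_indep _ _ _ _ _ _ _ hU hU' hV (div_ne_zero hW0 hU)
      (div_ne_zero (mul_ne_zero hU hV') hW0)
  · intro p
    have := cpMon_map ρ.toRingHom (cpGen 0) (cpGen 1) (cpGen 2) (cpGen 3) p
    rw [← r0, ← r1, ← r2, ← r3]
    exact this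

theorem cp_indep {k : Type u} [Field k] [CharP k 2]
    (a b u0 u1 v0 v1 w0 w1 : k)
    (hnorm : (u0 ^ 2 + u0 * u1 + a * u1 ^ 2) * (v0 ^ 2 + v0 * v1 + b * v1 ^ 2) =
      w0 ^ 2 + w0 * w1 + (a + b) * w1 ^ 2)
    (hu : u0 ^ 2 + u0 * u1 + a * u1 ^ 2 ≠ 0) (hv : v0 ^ 2 + v0 * v1 + b * v1 ^ 2 ≠ 0) :
    LinearIndependent k (cpMon (cpGen 0) (cpGen 1) (cpGen 2) (cpGen 3) :
      _ → CrossedProd k a b u0 u1 v0 v1 w0 w1) := by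
  have : CharP (AlgebraicClosure k) 2 := charP_of_injective_algebraMap (algebraMap k _).injective 2
  obtain ⟨ρ, α, β, n, m, -, -, -, -, -, hli, hρ⟩ := cp_rep (Ω := AlgebraicClosure k) a b u0 u1 v0 v1 w0 w1 hnorm hu hv
  have h1 := hli.restrict_scalars (R := k) (by
    intro p q h
    simpa [Algebra.smul_def] using h)
  refine LinearIndependent.of_comp ρ.toLinearMap ?_
  have h3 : ρ.toLinearMap ∘ cpMon (cpGen 0) (cpGen 1) (cpGen 2) (cpGen 3) = _ := funext hρ
  rw [h3]
  exact h1

theorem ee0 {Ω : Type*} [Field Ω] [CharP Ω 2] (c : Fin 4 × Fin 4 → Ω) (g : Fin 4) (α β a b : Ω)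
    (ha : α * α + α = a) (hb : β * β + β = b) :
   lf c g α β * lf c g α (β + 1) + lf c g α β * lf c g (α + 1) β + lf c g α β * lf c g (α + 1) (β + 1)
   + lf c g α (β + 1) * lf c g (α + 1) β
   + lf c g α (β + 1) * lf c g (α + 1) (β + 1) + lf c g (α + 1) β * lf c g (α + 1) (β + 1) =
   (c (1, g) ^ 2 + c (1, g) * c (2, g) + c (2, g) ^ 2) +
     c (3, g) * (c (0, g) + c (1, g) + c (2, g) + (a + b) * c (3, g)) := by
  subst ha hb
  unfold lf
  generalize c (0, g) = c0
  generalize c (1, g) = c1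
  generalize c (2, g) = c2
  generalize c (3, g) = c3
  grind

theorem ee1 {Ω : Type*} [Field Ω] [CharP Ω 2] (c : Fin 4 × Fin 4 → Ω) (α β a b s u0 u1 z0 z1 z2 z3 : Ω)
    (ha : α * α + α = a) (hb : β * β + β = b)
    (h0 : c (0, 1) = z0 + z2 * (u0 + u1)) (h1 : c (1, 1) = z2 * u1)
    (h2 : c (2, 1) = z1 + z3 * (u0 + u1)) (h3 : c (3, 1) = z3 * u1) :
    lf c 1 α β * lf c 1 α (β + 1) * (u0 * s + u1 * s * α) +
      lf c 1 (α + 1) β * lf c 1 (α + 1) (β + 1) * (u0 * s + u1 * s * (α + 1)) =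
    s * u1 * (z0 ^ 2 + z0 * z1 + b * z1 ^ 2 + (u0 ^ 2 + u0 * u1 + a * u1 ^ 2) *
      (z2 ^ 2 + z2 * z3 + b * z3 ^ 2)) := by
  subst ha hb
  unfold lf
  rw [h0, h1, h2, h3]
  grind

theorem ee2 {Ω : Type*} [Field Ω] [CharP Ω 2] (c : Fin 4 × Fin 4 → Ω) (α β a b t g z0 z1 z2 z3 : Ω)
    (ha : α * α + α = a) (hb : β * β + β = b)
    (h0 : c (0, 2) = z0 + z2 * (g + 1)) (h1 : c (1, 2) = z1 + z3 * (g + 1))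
    (h2 : c (2, 2) = z2) (h3 : c (3, 2) = z3) :
    lf c 2 α β * lf c 2 (α + 1) β * (g * t + t * β) +
      lf c 2 α (β + 1) * lf c 2 (α + 1) (β + 1) * (g * t + t * (β + 1)) =
    t * (z0 ^ 2 + z0 * z1 + a * z1 ^ 2 + (g ^ 2 + g + b) *
      (z2 ^ 2 + z2 * z3 + a * z3 ^ 2)) := by
  subst ha hb
  unfold lf
  rw [h0, h1, h2, h3]
  grind

theorem ee3 {Ω : Type*} [Field Ω] [CharP Ω 2] (c : Fin 4 × Fin 4 → Ω) (α β a b s w0 w1 z0 z1 z2 z3 : Ω)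
    (ha : α * α + α = a) (hb : β * β + β = b)
    (h0 : c (0, 3) = z0 + z2 * (w0 + w1) + z3 * w1 * a)
    (h1 : c (1, 3) = z2 * w1 + z1 + z3 * (w0 + w1) + z3 * w1)
    (h2 : c (2, 3) = z2 * w1) (h3 : c (3, 3) = z3 * w1) :
    lf c 3 α β * lf c 3 (α + 1) (β + 1) * (w0 * s + w1 * s * (α + β)) +
      lf c 3 α (β + 1) * lf c 3 (α + 1) β * (w0 * s + w1 * s * (α + β + 1)) =
    s * w1 * (z0 ^ 2 + z0 * z1 + a * z1 ^ 2 + (w0 ^ 2 + w0 * w1 + (a + b) * w1 ^ 2) *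
      (z2 ^ 2 + z2 * z3 + a * z3 ^ 2)) := by
  subst ha hb
  unfold lf
  rw [h0, h1, h2, h3]
  grind

def tco {k : Type*} [Field k] (a u0 u1 g w0 w1 : k) (z0 z1 z2 z3 : Fin 4 → k) (p : Fin 4 × Fin 4) : k :=
  (![z0,
    ![z1 0 + z1 2 * (u0 + u1), z1 2 * u1, z1 1 + z1 3 * (u0 + u1), z1 3 * u1],
    ![z2 0 + z2 2 * (g + 1), z2 1 + z2 3 * (g + 1), z2 2, z2 3],
    ![z3 0 + z3 2 * (w0 + w1) + z3 3 * w1 * a, z3 2 * w1 + z3 1 + z3 3 * (w0 + w1) + z3 3 * w1,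
      z3 2 * w1, z3 3 * w1]] : Fin 4 → Fin 4 → k) p.2 p.1

def q4 {k : Type*} [Field k] (b c : k) (z : Fin 4 → k) : k :=
  z 0 ^ 2 + z 0 * z 1 + b * z 1 ^ 2 + c * (z 2 ^ 2 + z 2 * z 3 + b * z 3 ^ 2)

def qL {k : Type*} [Field k] (a b : k) (z : Fin 4 → k) : k :=
  (z 1 ^ 2 + z 1 * z 2 + z 2 ^ 2) + z 3 * (z 0 + z 1 + z 2 + (a + b) * z 3)

theorem cp_s2 {k : Type u} [Field k] [CharP k 2] (a b u0 u1 g w0 w1 s t : k) (hs : s ≠ 0) (ht : t ≠ 0)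
    (hnorm : (u0 ^ 2 + u0 * u1 + a * u1 ^ 2) * (g ^ 2 + g + b) = w0 ^ 2 + w0 * w1 + (a + b) * w1 ^ 2)
    (hu : u0 ^ 2 + u0 * u1 + a * u1 ^ 2 ≠ 0) (hv : g ^ 2 + g + b ≠ 0)
    [Module.Finite k (CrossedProd k a b (u0 * s) (u1 * s) (g * t) t (w0 * (s * t)) (w1 * (s * t)))]
    (hrank : Module.finrank k (CrossedProd k a b (u0 * s) (u1 * s) (g * t) t (w0 * (s * t)) (w1 * (s * t))) = 16) :
    LinearIndependent k (cpMon (cpGen 0) (cpGen 1) (cpGen 2) (cpGen 3) :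
      _ → CrossedProd k a b (u0 * s) (u1 * s) (g * t) t (w0 * (s * t)) (w1 * (s * t))) ∧
    ∀ (z0 z1 z2 z3 : Fin 4 → k) (p : Polynomial k),
      p ^ 4 = (LinearMap.mulLeft k (∑ i, tco a u0 u1 g w0 w1 z0 z1 z2 z3 i •
        (cpMon (cpGen 0) (cpGen 1) (cpGen 2) (cpGen 3) i :
        CrossedProd k a b (u0 * s) (u1 * s) (g * t) t (w0 * (s * t)) (w1 * (s * t))))).charpoly →
      p.coeff 2 = qL a b z0 + s * u1 * q4 b (u0 ^ 2 + u0 * u1 + a * u1 ^ 2) z1 +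
        t * q4 a (g ^ 2 + g + b) z2 + s * t * w1 * q4 a (w0 ^ 2 + w0 * w1 + (a + b) * w1 ^ 2) z3 := by
  have hnorm' : ((u0 * s) ^ 2 + (u0 * s) * (u1 * s) + a * (u1 * s) ^ 2) *
      ((g * t) ^ 2 + (g * t) * t + b * t ^ 2) =
      (w0 * (s * t)) ^ 2 + (w0 * (s * t)) * (w1 * (s * t)) + (a + b) * (w1 * (s * t)) ^ 2 := by
    linear_combination s ^ 2 * t ^ 2 * hnorm
  have hu' : (u0 * s) ^ 2 + (u0 * s) * (u1 * s) + a * (u1 * s) ^ 2 ≠ 0 := by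
    have : (u0 * s) ^ 2 + (u0 * s) * (u1 * s) + a * (u1 * s) ^ 2 =
      s ^ 2 * (u0 ^ 2 + u0 * u1 + a * u1 ^ 2) := by ring
    rw [this]; exact mul_ne_zero (pow_ne_zero _ hs) hu
  have hv' : (g * t) ^ 2 + (g * t) * t + b * t ^ 2 ≠ 0 := by
    have : (g * t) ^ 2 + (g * t) * t + b * t ^ 2 = t ^ 2 * (g ^ 2 + g + b) := by ring
    rw [this]; exact mul_ne_zero (pow_ne_zero _ ht) hv
  have hli := cp_indep _ _ _ _ _ _ _ _ hnorm' hu' hv'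
  refine ⟨hli, ?_⟩
  have : CharP (AlgebraicClosure k) 2 := charP_of_injective_algebraMap (algebraMap k _).injective 2
  have neg1 : ∀ z : AlgebraicClosure k, -z = z := fun z => CharTwo.neg_eq z
  obtain ⟨ρ, α, β, n, m, hα, hβ, e1, e2, e3, hliM, hρ⟩ := cp_rep (Ω := AlgebraicClosure k) _ _ _ _ _ _ _ _ hnorm' hu' hv'
  intro z0 z1 z2 z3 p hp
  have key := charpoly_rep ρ
    (basisOfLinearIndependentOfCardEqFinrank hli (by simp [hrank]))
    (basisOfLinearIndependentOfCardEqFinrank hliM (by simp [Module.finrank_matrix]))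
    (by intro i; simp [hρ]) _ p hp
  have hsum : ρ (∑ i, tco a u0 u1 g w0 w1 z0 z1 z2 z3 i •
        cpMon (cpGen 0) (cpGen 1) (cpGen 2) (cpGen 3) i) = _ :=
    (show _ = _ by
      rw [map_sum]
      refine Finset.sum_congr rfl fun i _ => ?_
      rw [map_smul, hρ, ← algebraMap_smul (AlgebraicClosure k)] :
    _ = ∑ i, algebraMap k (AlgebraicClosure k) (tco a u0 u1 g w0 w1 z0 z1 z2 z3 i) • _).trans
    (cpMon_sum (fun i => algebraMap k (AlgebraicClosure k) (tco a u0 u1 g w0 w1 z0 z1 z2 z3 i)) _ _ _ _ _ _ _)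
  rw [hsum, mat4_charpoly_coeff] at key
  apply (algebraMap k (AlgebraicClosure k)).injective
  rw [key]
  set φ := algebraMap k (AlgebraicClosure k)
  set c : Fin 4 × Fin 4 → AlgebraicClosure k := fun i => φ (tco a u0 u1 g w0 w1 z0 z1 z2 z3 i) with hc
  have p0 := ee0 c 0 α β (φ a) (φ b) hα hβ
  have p1 := ee1 c α β (φ a) (φ b) (φ s) (φ u0) (φ u1) (φ (z1 0)) (φ (z1 1)) (φ (z1 2)) (φ (z1 3)) hα hβ
    (by simp [hc, tco]) (by simp [hc, tco]) (by simp [hc, tco]) (by simp [hc, tco])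
  have p2 := ee2 c α β (φ a) (φ b) (φ t) (φ g) (φ (z2 0)) (φ (z2 1)) (φ (z2 2)) (φ (z2 3)) hα hβ
    (by simp [hc, tco]) (by simp [hc, tco]) (by simp [hc, tco]) (by simp [hc, tco])
  have p3 := ee3 c α β (φ a) (φ b) (φ (s * t)) (φ w0) (φ w1) (φ (z3 0)) (φ (z3 1)) (φ (z3 2)) (φ (z3 3)) hα hβ
    (by simp [hc, tco]) (by simp [hc, tco]) (by simp [hc, tco]) (by simp [hc, tco])
  have c0 : ∀ i, c (i, 0) = φ (z0 i) := by intro i; simp [hc, tco]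
  simp only [c0] at p0
  simp only [map_mul] at e1 e2 e3 p3
  simp only [qL, q4, map_add, map_mul, map_pow]
  simp only [Matrix.of_apply, Matrix.cons_val]
  simp only [sub_eq_add_neg, neg1]
  rw [← p0, ← p1, ← p2, ← p3, ← e1, ← e2, ← e3]
  ring

def QE (k : Type*) [Field k] {V W : Type*} [AddCommGroup V] [Module k V] [AddCommGroup W] [Module k W]
    (f : V → k) (g : W → k) : Prop := ∃ e : V ≃ₗ[k] W, ∀ v, g (e v) = f v

section
variable {k : Type*} [Field k] {V W X Y : Type*} [AddCommGroup V] [Module k V] [AddCommGroup W] [Module k W]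
  [AddCommGroup X] [Module k X] [AddCommGroup Y] [Module k Y]

theorem QE.refl (f : V → k) : QE k f f := ⟨LinearEquiv.refl k V, fun _ => rfl⟩

theorem QE.symm {f : V → k} {g : W → k} (h : QE k f g) : QE k g f := by
  obtain ⟨e, he⟩ := h
  refine ⟨e.symm, fun v => ?_⟩
  rw [← he, e.apply_symm_apply]

theorem QE.trans {f : V → k} {g : W → k} {h : X → k} (h1 : QE k f g) (h2 : QE k g h) : QE k f h := by
  obtain ⟨e, he⟩ := h1
  obtain ⟨e', he'⟩ := h2
  exact ⟨e.trans e', fun v => by rw [LinearEquiv.trans_apply, he', he]⟩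

theorem QE.prod {f : V → k} {g : W → k} {f' : X → k} {g' : Y → k} (h1 : QE k f g) (h2 : QE k f' g') :
    QE k (fun v : V × X => f v.1 + f' v.2) (fun v : W × Y => g v.1 + g' v.2) := by
  obtain ⟨e, he⟩ := h1
  obtain ⟨e', he'⟩ := h2
  exact ⟨e.prodCongr e', fun v => by simp [he, he']⟩

theorem QE.mul {f : V → k} {g : W → k} (d : k) (h1 : QE k f g) :
    QE k (fun v => d * f v) (fun v => d * g v) := by
  obtain ⟨e, he⟩ := h1
  exact ⟨e, fun v => by simp [he]⟩

theorem QE.of_inj [FiniteDimensional k V] [FiniteDimensional k W] (L : V →ₗ[k] W)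
    (hd : Module.finrank k V = Module.finrank k W) {f : V → k} {g : W → k}
    (h : ∀ v, g (L v) = f v) (hL : ∀ v, L v = 0 → v = 0) : QE k f g := by
  refine ⟨LinearMap.linearEquivOfInjective L ?_ hd, fun v => ?_⟩
  · rw [injective_iff_map_eq_zero]; exact hL
  · rw [LinearMap.linearEquivOfInjective_apply, h]

theorem QE.of_linear [FiniteDimensional k V] [FiniteDimensional k W] (L : V →ₗ[k] W)
    (hd : Module.finrank k V = Module.finrank k W) {f : V → k} {g : W → k}
    (h : ∀ v, g (L v) = f v) (hnd : ∀ z, (∀ w, f (z + w) = f w) → z = 0) : QE k f g := by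
  refine QE.of_inj L hd h fun z hz => hnd z fun w => ?_
  rw [← h, ← h, map_add, hz, zero_add]
end

section
variable {k : Type*} [Field k] [CharP k 2]

theorem q4_nd (b c d : k) (hc : c ≠ 0) (hd : d ≠ 0) (z : Fin 4 → k)
    (h : ∀ w, d * q4 b c (z + w) = d * q4 b c w) : z = 0 := by
  have h0 := mul_left_cancel₀ hd (h ![0, 0, 0, 0])
  have h1 := mul_left_cancel₀ hd (h ![1, 0, 0, 0])
  have h2 := mul_left_cancel₀ hd (h ![0, 1, 0, 0])
  have h3 := mul_left_cancel₀ hd (h ![0, 0, 1, 0])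
  have h4 := mul_left_cancel₀ hd (h ![0, 0, 0, 1])
  simp only [q4, Pi.add_apply, Matrix.cons_val] at h0 h1 h2 h3 h4
  have e1 : z 1 = 0 := by grind
  have e0 : z 0 = 0 := by grind
  have e3 : c * z 3 = 0 := by grind
  have e2 : c * z 2 = 0 := by grind
  have e3' := (mul_eq_zero.1 e3).resolve_left hc
  have e2' := (mul_eq_zero.1 e2).resolve_left hc
  funext i; fin_cases i <;> assumption

def lin4 (l : Fin 4 → Fin 4 → k) : (Fin 4 → k) →ₗ[k] (Fin 4 → k) := Matrix.toLin' (Matrix.of l)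

theorem lin4_apply (l : Fin 4 → Fin 4 → k) (z : Fin 4 → k) (i : Fin 4) :
    lin4 l z i = l i 0 * z 0 + l i 1 * z 1 + l i 2 * z 2 + l i 3 * z 3 := by
  simp [lin4, Matrix.mulVec, dotProduct, Fin.sum_univ_four]

theorem q4_I1 (b c r : k) (hc : c ≠ 0) : QE k (q4 (b + r ^ 2 + r) c) (q4 b c) := by
  refine QE.of_linear (lin4 ![![1, r, 0, 0], ![0, 1, 0, 0], ![0, 0, 1, r], ![0, 0, 0, 1]]) rfl ?_
    fun z h => q4_nd _ _ 1 hc one_ne_zero z (by simpa using h)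
  intro v
  simp only [q4, lin4_apply, Matrix.cons_val]
  grind

theorem q4_I2 (b d h : k) (hc : d ≠ 0) : QE k (q4 (b + d * h ^ 2) d) (q4 b d) := by
  refine QE.of_linear (lin4 ![![1, 0, 0, h * d], ![0, 1, 0, 0], ![0, h, 1, 0], ![0, 0, 0, 1]]) rfl ?_
    fun z h => q4_nd _ _ 1 hc one_ne_zero z (by simpa using h)
  intro v
  simp only [q4, lin4_apply, Matrix.cons_val]
  grind

theorem q4_I3 (b c n0 n1 : k) (hc : c ≠ 0) (hN : n0 ^ 2 + n0 * n1 + b * n1 ^ 2 ≠ 0) :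
    QE k (q4 b (c * (n0 ^ 2 + n0 * n1 + b * n1 ^ 2))) (q4 b c) := by
  refine QE.of_linear (lin4 ![![1, 0, 0, 0], ![0, 1, 0, 0], ![0, 0, n0, b * n1], ![0, 0, n1, n0 + n1]]) rfl ?_
    fun z h => q4_nd _ _ 1 (mul_ne_zero hc hN) one_ne_zero z (by simpa using h)
  intro v
  simp only [q4, lin4_apply, Matrix.cons_val]
  grind

theorem q4_I4 (b c : k) (ζ : Fin 4 → k) (hc : c ≠ 0) (hN : q4 b c ζ ≠ 0) :
    QE k (fun z => q4 b c ζ * q4 b c z) (q4 b c) := by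
  refine QE.of_linear (lin4 ![![ζ 0, b * ζ 1, c * (ζ 2), c * (ζ 2 + b * ζ 3)],
    ![ζ 1, ζ 0 + ζ 1, c * ζ 3, c * ζ 2],
    ![ζ 2, ζ 2 + b * ζ 3, ζ 0, b * ζ 1], ![ζ 3, ζ 2, ζ 1, ζ 0 + ζ 1]]) rfl ?_
    fun z h => q4_nd _ _ _ hc hN z h
  intro v
  simp only [q4, lin4_apply, Matrix.cons_val]
  generalize ζ 0 = a0, ζ 1 = a1, ζ 2 = a2, ζ 3 = a3, v 0 = v0, v 1 = v1, v 2 = v2, v 3 = v3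
  clear hN
  grind
end

section
variable {k : Type u} [Field k]

theorem toQM_apply {n : Type*} [Fintype n] [DecidableEq n] (M : Matrix n n k) (v : n → k) :
    M.toQuadraticForm' v = ∑ i, ∑ j, M i j * v i * v j := by
  simp [Matrix.toQuadraticForm', Matrix.toLinearMap₂'_apply, mul_comm, mul_left_comm]

theorem pf_apply {m : ℕ} (a : Fin m → k) (b : k) (v : (Fin m → Bool) × Bool → k) :
    quadPfister a b v = ∑ S : Fin m → Bool, (∏ i, if S i then a i else 1) *
      (v (S, false) ^ 2 + v (S, false) * v (S, true) + b * v (S, true) ^ 2) := by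
  refine (toQM_apply _ v).trans ?_
  rw [Fintype.sum_prod_type]
  refine Finset.sum_congr rfl fun S _ => ?_
  simp only [Fintype.sum_bool, Fintype.sum_prod_type, pfisterMatrix]
  rw [← Finset.sum_add_distrib]
  rw [Finset.sum_eq_single S]
  · simp
    ring
  · intro T _ hT
    simp [Ne.symm hT]
  · simp

theorem f11_apply (v : Fin 2 → k) : formOneOne k v = v 0 ^ 2 + v 0 * v 1 + v 1 ^ 2 := by
  refine (toQM_apply _ v).trans ?_
  simp [Fin.sum_univ_two]
  ring

theorem hyp_apply (m : ℕ) (v : Fin m × Fin 2 → k) : hypForm k m v = ∑ i, v (i, 0) * v (i, 1) := by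
  refine (toQM_apply _ v).trans ?_
  rw [Fintype.sum_prod_type]
  refine Finset.sum_congr rfl fun i _ => ?_
  simp only [Fin.sum_univ_two, Fintype.sum_prod_type]
  rw [← Finset.sum_add_distrib]
  rw [Finset.sum_eq_single i]
  · simp
  · intro j _ hj
    simp [Ne.symm hj]
  · simp

def bEq1 : Bool ≃ (Fin 1 → Bool) where
  toFun a := ![a]
  invFun S := S 0
  left_inv a := rfl
  right_inv S := by ext i; fin_cases i; rfl

def bEq3 : Bool × Bool × Bool ≃ (Fin 3 → Bool) where
  toFun a := ![a.1, a.2.1, a.2.2]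
  invFun S := (S 0, S 1, S 2)
  left_inv a := rfl
  right_inv S := by ext i; fin_cases i <;> rfl

theorem bEq1_apply (a : Bool) : bEq1 a = ![a] := rfl

theorem bEq3_apply (a : Bool × Bool × Bool) : bEq3 a = ![a.1, a.2.1, a.2.2] := rfl

def pfL1 (k : Type*) [Field k] : ((Fin 1 → Bool) × Bool → k) →ₗ[k] (Fin 4 → k) where
  toFun v := ![v (![false], false), v (![false], true), v (![true], false), v (![true], true)]
  map_add' v w := by ext i; fin_cases i <;> rfl
  map_smul' v w := by ext i; fin_cases i <;> rfl

theorem pf1_QE (c b : k) : QE k (quadPfister (fun _ : Fin 1 => c) b) (q4 b c) := by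
  refine QE.of_inj (pfL1 k) (by simp) ?_ ?_
  · intro v
    rw [pf_apply, ← bEq1.sum_comp]
    simp [pfL1, q4, bEq1_apply]
    ring
  · intro v hv
    funext ⟨S, e⟩
    have hS : S = ![S 0] := by ext i; fin_cases i; rfl
    rw [hS]
    generalize S 0 = a0
    cases a0 <;> cases e <;>
    first
    | exact congrFun hv 0
    | exact congrFun hv 1
    | exact congrFun hv 2
    | exact congrFun hv 3

def pfL3 (k : Type*) [Field k] : ((Fin 3 → Bool) × Bool → k) →ₗ[k]
    ((Fin 4 → k) × (Fin 4 → k) × (Fin 4 → k) × (Fin 4 → k)) where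
  toFun v := (
   ![v (![false, false, false], false), v (![false, false, false], true),
     v (![false, false, true], false), v (![false, false, true], true)],
   ![v (![true, false, false], false), v (![true, false, false], true),
     v (![true, false, true], false), v (![true, false, true], true)],
   ![v (![false, true, false], false), v (![false, true, false], true),
     v (![false, true, true], false), v (![false, true, true], true)],
   ![v (![true, true, false], false), v (![true, true, false], true),
     v (![true, true, true], false), v (![true, true, true], true)])
  map_add' v w := by
    refine Prod.ext ?_ (Prod.ext ?_ (Prod.ext ?_ ?_)) <;> (ext i; fin_cases i <;> rfl)
  map_smul' v w := by
    refine Prod.ext ?_ (Prod.ext ?_ (Prod.ext ?_ ?_)) <;> (ext i; fin_cases i <;> rfl)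

def piSum (s t b c : k) (v : (Fin 4 → k) × (Fin 4 → k) × (Fin 4 → k) × (Fin 4 → k)) : k :=
  q4 b c v.1 + (s * q4 b c v.2.1 + (t * q4 b c v.2.2.1 + s * t * q4 b c v.2.2.2))

theorem pfL3_inj (v) (hv : pfL3 k v = 0) : v = 0 := by
  have h1 := congrArg Prod.fst hv
  have h2 := congrArg (fun z => z.2.1) hv
  have h3 := congrArg (fun z => z.2.2.1) hv
  have h4 := congrArg (fun z => z.2.2.2) hv
  funext ⟨S, e⟩
  have hS : S = ![S 0, S 1, S 2] := by ext i; fin_cases i <;> rfl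
  rw [hS]
  generalize S 0 = a0
  generalize S 1 = a1
  generalize S 2 = a2
  cases a0 <;> cases a1 <;> cases a2 <;> cases e <;>
  first
  | exact congrFun h1 0
  | exact congrFun h1 1
  | exact congrFun h1 2
  | exact congrFun h1 3
  | exact congrFun h2 0
  | exact congrFun h2 1
  | exact congrFun h2 2
  | exact congrFun h2 3
  | exact congrFun h3 0
  | exact congrFun h3 1
  | exact congrFun h3 2
  | exact congrFun h3 3
  | exact congrFun h4 0
  | exact congrFun h4 1
  | exact congrFun h4 2
  | exact congrFun h4 3

theorem pfL3_apply (s t c b : k) (v) : piSum s t b c (pfL3 k v) = quadPfister ![s, t, c] b v := by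
  rw [pf_apply, ← bEq3.sum_comp]
  simp [pfL3, piSum, q4, bEq3_apply, Fin.prod_univ_three, Fintype.sum_prod_type]
  ring

theorem pf3_QE (s t c b : k) : QE k (quadPfister ![s, t, c] b) (piSum s t b c) :=
  QE.of_inj (pfL3 k) (by simp) (pfL3_apply s t c b) pfL3_inj

end

section
variable {k : Type u} [Field k] [CharP k 2]

def qLmap (a b c : k) : ((Fin 2 → k) × (Fin 4 → k) × (Fin 4 → k)) →ₗ[k]
    ((Fin 4 → k) × (Fin 3 × Fin 2 → k)) where
  toFun v := (![(v.2.1 0 + v.2.2 0 + v.2.1 1) + v.1 0 + v.1 1 + (a + b) * (v.2.1 0 + v.2.2 0),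
      v.1 0, v.1 1, v.2.1 0 + v.2.2 0],
    fun p => (![![v.2.1 1 + v.2.2 1, a * (v.2.1 1 + v.2.2 1) + v.2.2 0],
      ![c * (v.2.1 2 + v.2.2 2), v.2.1 2 + v.2.2 2 + v.2.1 3],
      ![c * (v.2.1 3 + v.2.2 3), a * (v.2.1 3 + v.2.2 3) + v.2.2 2]] : Fin 3 → Fin 2 → k) p.1 p.2)
  map_add' v w := by
    refine Prod.ext ?_ ?_
    · funext i; fin_cases i <;> simp <;> ring
    · funext ⟨i, j⟩; fin_cases i <;> fin_cases j <;> simp <;> ring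
  map_smul' r v := by
    refine Prod.ext ?_ ?_
    · funext i; fin_cases i <;> simp <;> ring
    · funext ⟨i, j⟩; fin_cases i <;> fin_cases j <;> simp <;> ring

theorem qL_QE (a b c : k) (hc : c ≠ 0) :
    QE k (fun v : (Fin 2 → k) × (Fin 4 → k) × (Fin 4 → k) =>
        formOneOne k v.1 + (q4 a c v.2.1 + q4 a c v.2.2))
      (fun v : (Fin 4 → k) × (Fin 3 × Fin 2 → k) => qL a b v.1 + hypForm k 3 v.2) := by
  refine QE.of_inj (qLmap a b c) (by simp) ?_ ?_
  · rintro ⟨ξ, z, w⟩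
    simp [f11_apply, hyp_apply, qLmap, qL, q4, Fin.sum_univ_three]
    grind
  · rintro ⟨ξ, z, w⟩ h
    have h1 := congrArg Prod.fst h
    have h2 := congrArg Prod.snd h
    have a0 := congrFun h1 0
    have a1 := congrFun h1 1
    have a2 := congrFun h1 2
    have a3 := congrFun h1 3
    have b0 := congrFun h2 (0, 0)
    have b1 := congrFun h2 (0, 1)
    have b2 := congrFun h2 (1, 0)
    have b3 := congrFun h2 (1, 1)
    have b4 := congrFun h2 (2, 0)
    have b5 := congrFun h2 (2, 1)
    simp [qLmap, hc] at a0 a1 a2 a3 b0 b1 b2 b3 b4 b5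
    rw [b0] at b1
    rw [b4] at b5
    rw [b2] at b3
    simp at b1 b3 b5
    rw [a1, a2, a3] at a0
    simp at a0
    simp [b1] at a3
    simp [a0] at b0
    simp [b3] at b4
    simp [b5] at b2
    refine Prod.ext ?_ (Prod.ext ?_ ?_) <;> (funext i; fin_cases i <;> simp [*])

theorem chain_u (x y u0 u1 g w0 w1 : k) (hu1 : u1 ≠ 0)
    (hu : u0 ^ 2 + u0 * u1 + x * u1 ^ 2 ≠ 0) (hv : g ^ 2 + g + y ≠ 0)
    (hn : (u0 ^ 2 + u0 * u1 + x * u1 ^ 2) * (g ^ 2 + g + y) = w0 ^ 2 + w0 * w1 + (x + y) * w1 ^ 2) :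
    QE k (q4 y (u0 ^ 2 + u0 * u1 + x * u1 ^ 2)) (q4 x (g ^ 2 + g + y)) := by
  set Nu := u0 ^ 2 + u0 * u1 + x * u1 ^ 2 with hNu
  set Nv := g ^ 2 + g + y with hNv
  have hw : w0 ^ 2 + w0 * w1 + (x + y) * w1 ^ 2 ≠ 0 := by rw [← hn]; exact mul_ne_zero hu hv
  have s1 : QE k (q4 y Nu) (q4 (x + y) Nu) := by
    have e : y = (x + y) + Nu * (1 / u1) ^ 2 + (u0 / u1) ^ 2 + (u0 / u1) := by
      rw [hNu]; field_simp; grind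
    have := (q4_I1 (x + y + Nu * (1 / u1) ^ 2) Nu (u0 / u1) hu).trans (q4_I2 (x + y) Nu (1 / u1) hu)
    rwa [← e] at this
  have s2 : QE k (q4 (x + y) Nu) (q4 (x + y) Nv) := by
    have h1 := q4_I3 (x + y) Nu w0 w1 hu hw
    have h2 := q4_I3 (x + y) Nv Nu 0 hv (by simpa using hu)
    have e : Nu * (w0 ^ 2 + w0 * w1 + (x + y) * w1 ^ 2) = Nv * (Nu ^ 2 + Nu * 0 + (x + y) * 0 ^ 2) := by
      rw [← hn]; ring
    rw [e] at h1
    exact h1.symm.trans h2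
  have s3 : QE k (q4 (x + y) Nv) (q4 x Nv) := by
    have e : x + y = x + Nv * 1 ^ 2 + g ^ 2 + g := by
      rw [hNv]; grind
    have := (q4_I1 (x + Nv * 1 ^ 2) Nv g hv).trans (q4_I2 x Nv 1 hv)
    rwa [← e] at this
  exact s1.trans (s2.trans s3)

theorem chain_w (x y u0 u1 g w0 w1 : k)
    (hu : u0 ^ 2 + u0 * u1 + x * u1 ^ 2 ≠ 0) (hv : g ^ 2 + g + y ≠ 0)
    (hn : (u0 ^ 2 + u0 * u1 + x * u1 ^ 2) * (g ^ 2 + g + y) = w0 ^ 2 + w0 * w1 + (x + y) * w1 ^ 2) :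
    QE k (q4 x (w0 ^ 2 + w0 * w1 + (x + y) * w1 ^ 2)) (q4 x (g ^ 2 + g + y)) := by
  rw [← hn, mul_comm]
  exact q4_I3 x _ u0 u1 hv hu

theorem u1_ne (x y u0 u1 g w0 w1 : k) (hv : g ^ 2 + g + y ≠ 0)
    (hu : u0 ^ 2 + u0 * u1 + x * u1 ^ 2 ≠ 0)
    (hn : (u0 ^ 2 + u0 * u1 + x * u1 ^ 2) * (g ^ 2 + g + y) = w0 ^ 2 + w0 * w1 + (x + y) * w1 ^ 2)
    (han : ∀ z, q4 x (g ^ 2 + g + y) z = 0 → z = 0) : u1 ≠ 0 := by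
  rintro rfl
  have h0 : u0 ≠ 0 := by rintro rfl; simp at hu
  have h := han ![w0 + w1 * g, w1, u0 + w1, 0] (by simp [q4]; grind)
  have h1 := congrFun h 1
  have h2 := congrFun h 2
  simp at h1 h2
  rw [h1] at h2
  simp at h2
  exact h0 h2

theorem w1_ne (x y u0 u1 g w0 w1 : k) (hv : g ^ 2 + g + y ≠ 0)
    (hu : u0 ^ 2 + u0 * u1 + x * u1 ^ 2 ≠ 0)
    (hn : (u0 ^ 2 + u0 * u1 + x * u1 ^ 2) * (g ^ 2 + g + y) = w0 ^ 2 + w0 * w1 + (x + y) * w1 ^ 2)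
    (han : ∀ z, q4 x (g ^ 2 + g + y) z = 0 → z = 0) : w1 ≠ 0 := by
  rintro rfl
  have h := han ![w0, 0, u0, u1] (by simp [q4]; grind)
  have h1 := congrFun h 2
  have h2 := congrFun h 3
  simp at h1 h2
  rw [h1, h2] at hu
  simp at hu

end

theorem div_sep {K A ι : Type*} [Field K] [Ring A] [Algebra K A] (hA : IsDivisionAlg A)
    (hc : ∀ z : A, (∀ c, z * c = c * z) → ∃ r : K, z = algebraMap K A r)
    (b : ι → A) (hb : LinearIndependent K b) (S : Finset ι) :
    ∀ a : ι → A, (∀ z, ∑ i ∈ S, a i * z * b i = 0) → ∀ i ∈ S, a i = 0 := by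
  classical
  induction S using Finset.induction_on with
  | empty => intro a _ i hi; simp at hi
  | insert i0 S hi0 ih =>
    intro a h
    by_cases h0 : a i0 = 0
    · intro i hi
      rcases Finset.mem_insert.1 hi with rfl | hi
      · exact h0
      · refine ih a (fun z => ?_) i hi
        have := h z
        rwa [Finset.sum_insert hi0, h0, zero_mul, zero_mul, zero_add] at this
    · exfalso
      obtain ⟨w, hw⟩ := hA.2 _ h0
      have hw' : (↑w⁻¹ : A) * a i0 = 1 := by rw [← hw]; simp
      have h' : ∀ z, z * b i0 + ∑ i ∈ S, (↑w⁻¹ * a i) * z * b i = 0 := by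
        intro z
        have := congrArg (fun y => (↑w⁻¹ : A) * y) (h z)
        simp only [mul_zero] at this
        rw [Finset.sum_insert hi0, mul_add, Finset.mul_sum] at this
        rw [← this]
        congr 1
        · rw [← mul_assoc, ← mul_assoc, hw', one_mul]
        · refine Finset.sum_congr rfl fun i _ => by simp only [mul_assoc]
      have hcomm : ∀ c, ∀ i ∈ S, (↑w⁻¹ * a i) * c - c * (↑w⁻¹ * a i) = 0 := by
        intro c
        refine ih _ fun z => ?_
        have e1 := h' (c * z)
        have e2 := congrArg (fun y => c * y) (h' z)
        simp only [mul_zero, mul_add, Finset.mul_sum] at e2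
        have e3 : ∑ i ∈ S, (↑w⁻¹ * a i * c - c * (↑w⁻¹ * a i)) * z * b i =
          ∑ i ∈ S, (↑w⁻¹ * a i) * (c * z) * b i - ∑ i ∈ S, c * ((↑w⁻¹ * a i) * z * b i) := by
          rw [← Finset.sum_sub_distrib]
          refine Finset.sum_congr rfl fun i _ => by simp only [sub_mul, mul_assoc]
        rw [e3, eq_neg_of_add_eq_zero_right e1, eq_neg_of_add_eq_zero_right e2, mul_assoc, sub_self]
      have hr : ∀ i, ∃ r : K, i ∈ S → (↑w⁻¹ * a i) = algebraMap K A r := by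
        intro i
        by_cases hi : i ∈ S
        · obtain ⟨r, hr⟩ := hc (↑w⁻¹ * a i) fun c => sub_eq_zero.1 (hcomm c i hi)
          exact ⟨r, fun _ => hr⟩
        · exact ⟨0, fun h => absurd h hi⟩
      choose r hr using hr
      have e := h' 1
      rw [linearIndependent_iff'] at hb
      have := hb (insert i0 S) (fun i => if i = i0 then 1 else r i) ?_ i0 (Finset.mem_insert_self _ _)
      · simp at this
      · rw [Finset.sum_insert hi0, ← e]
        congr 1
        · simp
        · refine Finset.sum_congr rfl fun i hi => ?_
          have : i ≠ i0 := by rintro rfl; exact hi0 hi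
          simp [this, hr i hi, Algebra.smul_def]

theorem div_split {K A : Type*} [Field K] [Ring A] [Algebra K A] [Module.Finite K A]
    (hA : IsDivisionAlg A)
    (hc : ∀ z : A, (∀ c, z * c = c * z) → ∃ r : K, z = algebraMap K A r)
    (f : A →ₐ[K] Aᵐᵒᵖ) : IsSplitAlg K (A ⊗[K] A) := by
  haveI := hA.1
  have hfi : Function.Injective f := by
    rw [injective_iff_map_eq_zero]
    intro z hz
    by_contra h
    have := (hA.2 z h).map f
    rw [hz] at this
    exact not_isUnit_zero this
  have hfb : Function.Bijective f := by
    refine ⟨hfi, ?_⟩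
    have : Module.finrank K A = Module.finrank K Aᵐᵒᵖ :=
      (MulOpposite.opLinearEquiv K : A ≃ₗ[K] Aᵐᵒᵖ).finrank_eq
    exact (LinearMap.injective_iff_surjective_of_finrank_eq_finrank (f := f.toLinearMap) this).1 hfi
  let e : A ≃ₐ[K] Aᵐᵒᵖ := AlgEquiv.ofBijective f hfb
  let b := Module.finBasis K A
  let b' := b.map (MulOpposite.opLinearEquiv K : A ≃ₗ[K] Aᵐᵒᵖ)
  have hmi : Function.Injective (AlgHom.mulLeftRight K A) := by
    rw [injective_iff_map_eq_zero]
    intro X hX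
    let E := TensorProduct.equivFinsuppOfBasisRight (M := A) b'
    have hXe : X = ∑ i, E X i ⊗ₜ[K] b' i := by
      have h1 := E.symm_apply_apply X
      rw [TensorProduct.equivFinsuppOfBasisRight_symm_apply] at h1
      rw [Finsupp.sum_fintype] at h1
      · exact h1.symm
      · simp
    have h0 := div_sep (K := K) hA hc b b.linearIndependent Finset.univ (fun i => E X i) ?_
    · rw [hXe]
      exact Finset.sum_eq_zero fun i hi => by rw [h0 i hi, TensorProduct.zero_tmul]
    · intro z
      have h1 := congrArg (fun φ => φ z) hX
      rw [hXe] at h1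
      simpa [b', AlgHom.mulLeftRight_apply] using h1
  have hd : Module.finrank K (A ⊗[K] Aᵐᵒᵖ) = Module.finrank K (Module.End K A) := by
    rw [Module.finrank_tensorProduct, Module.finrank_linearMap,
      (MulOpposite.opLinearEquiv K : A ≃ₗ[K] Aᵐᵒᵖ).finrank_eq]
  have hmb : Function.Bijective (AlgHom.mulLeftRight K A) :=
    ⟨hmi, (LinearMap.injective_iff_surjective_of_finrank_eq_finrank
      (f := (AlgHom.mulLeftRight K A).toLinearMap) hd).1 hmi⟩
  exact ⟨Module.finrank K A, Module.finrank_pos,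
    ⟨((Algebra.TensorProduct.congr AlgEquiv.refl e).trans (AlgEquiv.ofBijective _ hmb)).trans
      (LinearMap.toMatrixAlgEquiv b)⟩⟩

theorem central_of_exp {K : Type u} {A : Type u} [Field K] [Ring A] [Algebra K A] [Nontrivial A]
    (h : IsSplitAlg K ((A ⊗[K] A) ⊗[K] (A ⊗[K] A))) :
    ∀ z : A, (∀ c, z * c = c * z) → ∃ r : K, z = algebraMap K A r := by
  obtain ⟨n, hn, ⟨e⟩⟩ := h
  haveI : Nonempty (Fin n) := ⟨⟨0, hn⟩⟩
  haveI : Algebra.IsCentral K ((A ⊗[K] A) ⊗[K] (A ⊗[K] A)) :=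
    Algebra.IsCentral.of_algEquiv K _ _ e.symm
  haveI : Algebra.IsCentral K (A ⊗[K] A) := Algebra.IsCentral.left_of_tensor_of_field K _ (A ⊗[K] A)
  haveI : Algebra.IsCentral K A := Algebra.IsCentral.left_of_tensor_of_field K _ A
  intro z hz
  have : z ∈ Subalgebra.center K A := by
    rw [Subalgebra.mem_center_iff]; exact fun c => (hz c).symm
  have := Algebra.IsCentral.out this
  obtain ⟨r, hr⟩ := Algebra.mem_bot.1 this
  exact ⟨r, hr.symm⟩

section
variable {K A C : Type*} [Field K] [CharP K 2] [Ring A] [Algebra K A] [CommRing C] [Algebra K C]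

def qf (w0 w1 a0 b0 a1 b1 : K) (al be : C) : C :=
  (algebraMap K C a0 + algebraMap K C a1 * (algebraMap K C w0 + algebraMap K C w1 * (al + be + 1))) +
  (algebraMap K C b0 + algebraMap K C b1 * (algebraMap K C w0 + algebraMap K C w1 * (al + be + 1))) * al

theorem semi_scalar (d : A) (r : K) : SemiconjBy d (algebraMap K A r) (algebraMap K A r) :=
  (Algebra.commutes r d).symm

theorem wf_semi (i : C →ₐ[K] A) (w0 w1 : K) (al be al' be' : C) (d : A)
    (h1 : SemiconjBy d (i al) (i al')) (h2 : SemiconjBy d (i be) (i be')) :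
    SemiconjBy d (i (algebraMap K C w0 + algebraMap K C w1 * (al + be + 1)))
      (i (algebraMap K C w0 + algebraMap K C w1 * (al' + be' + 1))) := by
  simp only [map_add, map_mul, AlgHom.commutes, map_one]
  exact (semi_scalar d w0).add_right ((semi_scalar d w1).mul_right
    ((h1.add_right h2).add_right (SemiconjBy.one_right d)))

theorem qf_semi (i : C →ₐ[K] A) (w0 w1 a0 b0 a1 b1 : K) (al be al' be' : C) (d : A)
    (h1 : SemiconjBy d (i al) (i al')) (h2 : SemiconjBy d (i be) (i be')) :
    SemiconjBy d (i (qf w0 w1 a0 b0 a1 b1 al be)) (i (qf w0 w1 a0 b0 a1 b1 al' be')) := by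
  have hw := wf_semi i w0 w1 al be al' be' d h1 h2
  unfold qf
  simp only [map_add, map_mul, AlgHom.commutes, map_one] at hw ⊢
  exact ((semi_scalar d a0).add_right ((semi_scalar d a1).mul_right hw)).add_right
    (((semi_scalar d b0).add_right ((semi_scalar d b1).mul_right hw)).mul_right h1)

theorem qf_key (x y w0 w1 a0 b0 a1 b1 : K) (al be : C)
    (ha : al * al + al = algebraMap K C x) (hb : be * be + be = algebraMap K C y)
    (hN : a0 ^ 2 + a0 * b0 + x * b0 ^ 2 = (w0 ^ 2 + w0 * w1 + (x + y) * w1 ^ 2) *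
      (a1 ^ 2 + a1 * b1 + x * b1 ^ 2)) :
    qf w0 w1 a0 b0 a1 b1 al be * qf w0 w1 a0 b0 a1 b1 (al + 1) (be + 1) *
      (algebraMap K C w0 + algebraMap K C w1 * (al + be)) =
    qf w0 w1 a0 b0 a1 b1 al (be + 1) * qf w0 w1 a0 b0 a1 b1 (al + 1) be *
      (algebraMap K C w0 + algebraMap K C w1 * (al + be + 1)) := by
  have h2 : (2 : C) = 0 := by
    have : (2 : K) = 0 := CharTwo.two_eq_zero
    have := congrArg (algebraMap K C) this
    rwa [map_ofNat, map_zero] at this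
  have hN' := congrArg (algebraMap K C) hN
  simp only [map_add, map_mul, map_pow] at hN'
  unfold qf
  generalize algebraMap K C w0 = W0 at *
  generalize algebraMap K C w1 = W1 at *
  generalize algebraMap K C a0 = A0 at *
  generalize algebraMap K C a1 = A1 at *
  generalize algebraMap K C b0 = B0 at *
  generalize algebraMap K C b1 = B1 at *
  generalize algebraMap K C x = X at *
  generalize algebraMap K C y = Y at *
  set W := W0 + W1 * (al + be) with hW
  set V := W0 + W1 * (al + be + 1) with hV
  have e1 : W0 + W1 * (al + (be + 1) + 1) = W := by linear_combination W1 * h2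
  have e2 : W0 + W1 * (al + 1 + be + 1) = W := by linear_combination W1 * h2
  have e3 : W0 + W1 * (al + 1 + (be + 1) + 1) = V := by linear_combination W1 * h2
  rw [e1, e2, e3]
  have hWV : W * V = W0 ^ 2 + W0 * W1 + (X + Y) * W1 ^ 2 := by
    rw [hW, hV]
    linear_combination W1 ^ 2 * ha + W1 ^ 2 * hb + (W0 * W1 * (al + be) + W1 ^ 2 * al * be) * h2
  rw [← hWV] at hN'
  clear_value W V
  have f1 : (A0 + A1 * V + (B0 + B1 * V) * al) * (A0 + A1 * V + (B0 + B1 * V) * (al + 1)) =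
    (A0 + A1 * V) ^ 2 + (A0 + A1 * V) * (B0 + B1 * V) + X * (B0 + B1 * V) ^ 2 := by
    linear_combination (B0 + B1 * V) ^ 2 * ha + (A0 + A1 * V) * (B0 + B1 * V) * al * h2
  have f2 : (A0 + A1 * W + (B0 + B1 * W) * al) * (A0 + A1 * W + (B0 + B1 * W) * (al + 1)) =
    (A0 + A1 * W) ^ 2 + (A0 + A1 * W) * (B0 + B1 * W) + X * (B0 + B1 * W) ^ 2 := by
    linear_combination (B0 + B1 * W) ^ 2 * ha + (A0 + A1 * W) * (B0 + B1 * W) * al * h2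
  rw [f1, f2]
  linear_combination (W - V) * hN'

theorem anti_rel (i : C →ₐ[K] A) (x y u0 u1 v0 v1 w0 w1 : K) (al be q qs qt qst : C) (la de p : A)
    (h : CPRel K A x y u0 u1 v0 v1 w0 w1 (i al) (i be) la de) (hla : IsUnit la)
    (h1 : SemiconjBy la (i q) (i qs)) (h1' : SemiconjBy la (i qs) (i q))
    (h2 : SemiconjBy de (i q) (i qt)) (h3 : SemiconjBy (de * la) (i q) (i qst))
    (hp : p * i q = 1) (hp' : i q * p = 1)
    (pst : A) (hpst : pst * i qst = 1) (hpst' : i qst * pst = 1)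
    (hk : q * qst * (algebraMap K C w0 + algebraMap K C w1 * (al + be)) =
      qs * qt * (algebraMap K C w0 + algebraMap K C w1 * (al + be + 1))) :
    CPRel K Aᵐᵒᵖ x y u0 u1 v0 v1 w0 w1 (.op (i al)) (.op (i be)) (.op la) (.op (p * de * i q)) := by
  have h20 : (2 : A) = 0 := by
    have : (2 : K) = 0 := CharTwo.two_eq_zero
    have := congrArg (algebraMap K A) this
    rwa [map_ofNat, map_zero] at this
  have hdbl : ∀ z : A, z + z = 0 := fun z => by rw [← two_mul, h20, zero_mul]
  have cC : ∀ c d : C, i c * i d = i d * i c := fun c d => by rw [← map_mul, mul_comm, map_mul]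
  have cp : ∀ c : C, p * i c = i c * p := by
    intro c
    calc p * i c = p * (i c * (i q * p)) := by rw [hp', mul_one]
      _ = p * i q * (i c * p) := by rw [← mul_assoc (i c), cC c q]; simp only [mul_assoc]
      _ = _ := by rw [hp, one_mul]
  have cps : ∀ c : C, pst * i c = i c * pst := by
    intro c
    calc pst * i c = pst * (i c * (i qst * pst)) := by rw [hpst', mul_one]
      _ = pst * i qst * (i c * pst) := by rw [← mul_assoc (i c), cC c qst]; simp only [mul_assoc]
      _ = _ := by rw [hpst, one_mul]
  have hm : ∀ r : K, algebraMap K Aᵐᵒᵖ r = MulOpposite.op (algebraMap K A r) := fun _ => rfl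
  have dp : (de * la) * p = pst * (de * la) := by
    have e := h3.eq
    calc (de * la) * p = pst * i qst * ((de * la) * p) := by rw [hpst, one_mul]
      _ = pst * (de * la * i q) * p := by rw [e]; simp only [mul_assoc]
      _ = pst * (de * la) * (i q * p) := by simp only [mul_assoc]
      _ = _ := by rw [hp', mul_one]
  have hW : la * de * (la * de) = i (algebraMap K C w0 + algebraMap K C w1 * (al + be)) := by
    rw [h.ww]; simp
  have hsw : la * i (algebraMap K C w0 + algebraMap K C w1 * (al + be + 1)) =
      i (algebraMap K C w0 + algebraMap K C w1 * (al + be)) * la := by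
    have := (wf_semi i w0 w1 al be al (be + 1) la (h.la_al) (by
      have := h.la_be
      unfold SemiconjBy
      rw [this, map_add, map_one, add_mul, one_mul])).eq
    rw [this]
    congr 1
    simp only [map_add, map_mul, AlgHom.commutes, map_one]
    have : i al + (i be + 1) + 1 = i al + i be := by
      rw [add_assoc, add_assoc, hdbl, add_zero]
    rw [this]
  have hdl : de * la * (de * la) = i (algebraMap K C w0 + algebraMap K C w1 * (al + be + 1)) := by
    refine hla.mul_left_cancel ?_
    rw [hsw, ← hW]; simp only [mul_assoc]
  constructor
  · rw [hm, ← h.aa]; simp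
  · rw [hm, ← h.bb]; simp
  · simp only [← MulOpposite.op_mul]; rw [h.ab]
  · simp only [← MulOpposite.op_mul]; rw [h.la_al]
  · simp only [← MulOpposite.op_mul, ← MulOpposite.op_add]
    rw [h.la_be, add_assoc, hdbl, add_zero]
  · simp only [← MulOpposite.op_mul]
    congr 1
    calc i be * (p * de * i q) = i be * p * de * i q := by simp only [mul_assoc]
      _ = p * (i be * de) * i q := by rw [← cp]; simp only [mul_assoc]
      _ = p * de * (i be * i q) := by rw [← h.de_be]; simp only [mul_assoc]
      _ = _ := by rw [cC]; simp only [mul_assoc]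
  · simp only [← MulOpposite.op_mul, ← MulOpposite.op_add]
    congr 1
    symm
    calc p * de * i q * i al + p * de * i q = p * (de * i al) * i q + p * de * i q := by
          rw [mul_assoc, cC]; simp only [mul_assoc]
      _ = p * i al * de * i q := by
          rw [h.de_al, mul_add, add_mul, add_assoc, hdbl, add_zero]; simp only [mul_assoc]
      _ = _ := by rw [cp]; simp only [mul_assoc]
  · simp only [← MulOpposite.op_mul]; rw [h.ll, hm, hm]
    simp only [← MulOpposite.op_mul, ← MulOpposite.op_add]
    rw [Algebra.commutes]
  · simp only [← MulOpposite.op_mul]; rw [hm, hm]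
    simp only [← MulOpposite.op_mul, ← MulOpposite.op_add]
    congr 1
    have hv : de * de = i (algebraMap K C v0 + algebraMap K C v1 * be) := by
      rw [h.dd]; simp
    calc p * de * i q * (p * de * i q) = p * de * (i q * p) * de * i q := by simp only [mul_assoc]
      _ = p * (de * de) * i q := by rw [hp', mul_one]; simp only [mul_assoc]
      _ = de * de * (p * i q) := by rw [hv, cp]; simp only [mul_assoc]
      _ = algebraMap K A v0 + i be * algebraMap K A v1 := by
        rw [hp, mul_one, h.dd, Algebra.commutes]
  · simp only [← MulOpposite.op_mul]; rw [hm, hm]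
    simp only [← MulOpposite.op_mul, ← MulOpposite.op_add]
    congr 1
    have hk' := congrArg i hk
    calc p * de * i q * la * (p * de * i q * la)
        = p * (de * i q) * (la * p) * de * (i q * la) := by simp only [mul_assoc]
      _ = p * i qt * ((de * la) * p) * de * (la * i qs) := by
          rw [h2.eq, ← h1'.eq]; simp only [mul_assoc]
      _ = p * i qt * pst * (de * la * (de * la)) * i qs := by
          rw [dp]; simp only [mul_assoc]
      _ = p * pst * i (qs * qt * (algebraMap K C w0 + algebraMap K C w1 * (al + be + 1))) := by
          rw [hdl, mul_assoc p (i qt), ← cps qt]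
          simp only [mul_assoc, ← map_mul]
          congr 3
          ring
      _ = p * pst * (i qst * i q * i (algebraMap K C w0 + algebraMap K C w1 * (al + be))) := by
          rw [← hk, map_mul, mul_comm q, map_mul]
      _ = p * (pst * i qst) * i q * i (algebraMap K C w0 + algebraMap K C w1 * (al + be)) := by
          simp only [mul_assoc]
      _ = algebraMap K A w0 + (i al + i be) * algebraMap K A w1 := by
          rw [hpst, mul_one, hp, one_mul, ← Algebra.commutes]; simp

end

section
variable {K : Type u} [Field K] [CharP K 2]

theorem ring_anti {A : Type*} [Ring A] [Algebra K A] (x y u0 u1 v0 v1 w0 w1 a0 b0 a1 b1 : K) (al be la de : A)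
    (h : CPRel K A x y u0 u1 v0 v1 w0 w1 al be la de)
    (hdiv : IsDivisionAlg A) (hla : la ≠ 0) (hde : de ≠ 0)
    (hN : (w1 = 0 ∧ b0 = 0 ∧ a1 = 0 ∧ b1 = 0) ∨
      a0 ^ 2 + a0 * b0 + x * b0 ^ 2 = (w0 ^ 2 + w0 * w1 + (x + y) * w1 ^ 2) *
      (a1 ^ 2 + a1 * b1 + x * b1 ^ 2))
    (hq : algebraMap K A (a0 + a1 * (w0 + w1) + b1 * w1 * x) +
      algebraMap K A (a1 * w1 + b0 + b1 * (w0 + w1) + b1 * w1) * al +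
      algebraMap K A (a1 * w1) * be + algebraMap K A (b1 * w1) * (al * be) ≠ 0) :
    ∃ de' : A, CPRel K Aᵐᵒᵖ x y u0 u1 v0 v1 w0 w1 (.op al) (.op be) (.op la) (.op de') := by
  have h2K : (2 : K) = 0 := CharTwo.two_eq_zero
  obtain ⟨C, iC, iA, i, al', be', hal, hbe, hi⟩ : ∃ (C : Type _) (_ : CommRing C) (_ : Algebra K C)
      (i : C →ₐ[K] A) (al' be' : C), i al' = al ∧ i be' = be ∧ Function.Injective i := by
    have hcomm : ∀ a ∈ ({al, be} : Set A), ∀ b ∈ ({al, be} : Set A), a * b = b * a := by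
      rintro a (rfl | rfl) b (rfl | rfl)
      · rfl
      · exact h.ab
      · exact h.ab.symm
      · rfl
    refine ⟨Algebra.adjoin K ({al, be} : Set A), Algebra.adjoinCommRingOfComm K hcomm, ?_⟩
    exact ⟨inferInstanceAs (Algebra K (Algebra.adjoin K ({al, be} : Set A))),
      (Algebra.adjoin K ({al, be} : Set A)).val,
      ⟨al, Algebra.subset_adjoin (by simp)⟩, ⟨be, Algebra.subset_adjoin (by simp)⟩, rfl, rfl,
      Subtype.val_injective⟩
  subst hal hbe
  have h2C : (2 : C) = 0 := by
    have := congrArg (algebraMap K C) h2K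
    rwa [map_ofNat, map_zero] at this
  have ha : al' * al' + al' = algebraMap K C x := hi (by simpa using h.aa)
  have hb : be' * be' + be' = algebraMap K C y := hi (by simpa using h.bb)
  have e11 : ∀ c : C, c + 1 + 1 = c := fun c => by linear_combination h2C
  have s1 : SemiconjBy la (i al') (i al') := h.la_al
  have s2 : SemiconjBy la (i be') (i (be' + 1)) := by
    rw [map_add, map_one, SemiconjBy, h.la_be, add_mul, one_mul]
  have s2' : SemiconjBy la (i (be' + 1)) (i be') := by
    have := s2.add_right (SemiconjBy.one_right la)
    rwa [← map_one i, ← map_add, ← map_add, e11] at this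
  have s3 : SemiconjBy de (i be') (i be') := h.de_be
  have s4 : SemiconjBy de (i al') (i (al' + 1)) := by
    rw [map_add, map_one, SemiconjBy, h.de_al, add_mul, one_mul]
  have s5 : SemiconjBy de (i (be' + 1)) (i (be' + 1)) := by
    rw [map_add, map_one]; exact s3.add_right (SemiconjBy.one_right de)
  have hu := fun z (hz : z ≠ 0) => hdiv.2 z hz
  have hlau := hu _ hla
  have hnt := hdiv.1
  have hq' : i (qf w0 w1 a0 b0 a1 b1 al' be') ≠ 0 := by
    intro h0
    apply hq
    rw [← h0]
    simp only [← AlgHom.commutes i, ← map_mul, ← map_add]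
    congr 1
    simp only [map_add, map_mul, qf]
    linear_combination (-(algebraMap K C b1 * algebraMap K C w1)) * ha + algebraMap K C w1 * algebraMap K C b1 * al' * h2C
  have hq0 : qf w0 w1 a0 b0 a1 b1 al' be' ≠ 0 := by
    intro h0; rw [h0, map_zero] at hq'; exact hq' rfl
  have hdlu : IsUnit de := hu _ hde
  have t3 : SemiconjBy (de * la) (i (qf w0 w1 a0 b0 a1 b1 al' be'))
      (i (qf w0 w1 a0 b0 a1 b1 (al' + 1) (be' + 1))) :=
    qf_semi i w0 w1 a0 b0 a1 b1 _ _ _ _ _ (s4.mul_left s1) (s5.mul_left s2)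
  have hqst : i (qf w0 w1 a0 b0 a1 b1 (al' + 1) (be' + 1)) ≠ 0 := by
    intro h0
    have := t3.eq
    rw [h0, zero_mul] at this
    exact ((hdlu.mul hlau).mul (hu _ hq')).ne_zero this
  obtain ⟨pu, hpu⟩ := hu _ hq'
  obtain ⟨ps, hps⟩ := hu _ hqst
  refine ⟨_, anti_rel i x y u0 u1 v0 v1 w0 w1 al' be' (qf w0 w1 a0 b0 a1 b1 al' be')
    (qf w0 w1 a0 b0 a1 b1 al' (be' + 1)) (qf w0 w1 a0 b0 a1 b1 (al' + 1) be')
    (qf w0 w1 a0 b0 a1 b1 (al' + 1) (be' + 1)) la de (↑pu⁻¹) h hlau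
    (qf_semi i w0 w1 a0 b0 a1 b1 _ _ _ _ _ s1 s2) (qf_semi i w0 w1 a0 b0 a1 b1 _ _ _ _ _ s1 s2')
    (qf_semi i w0 w1 a0 b0 a1 b1 _ _ _ _ _ s4 s3) t3 (by rw [← hpu]; simp) (by rw [← hpu]; simp)
    (↑ps⁻¹) (by rw [← hps]; simp) (by rw [← hps]; simp) ?_⟩
  rcases hN with ⟨rfl, rfl, rfl, rfl⟩ | hN
  · simp [qf]
  · exact qf_key x y w0 w1 a0 b0 a1 b1 al' be' ha hb hN

theorem lam_ne (x y u0 u1 v0 v1 w0 w1 : K) (hx : ∀ r : K, r ^ 2 + r ≠ y)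
    (hdiv : IsDivisionAlg (CrossedProd K x y u0 u1 v0 v1 w0 w1))
    (hc : ∀ z : CrossedProd K x y u0 u1 v0 v1 w0 w1, (∀ c, z * c = c * z) → ∃ r : K, z = algebraMap K _ r) :
    (cpGen 2 : CrossedProd K x y u0 u1 v0 v1 w0 w1) ≠ 0 := by
  intro h0
  have := hdiv.1
  have hrel := cp_rel (k := K) (a := x) (b := y) (u0 := u0) (u1 := u1) (v0 := v0) (v1 := v1)
    (w0 := w0) (w1 := w1)
  have hm := cp_central (cpGen 1 : CrossedProd K x y u0 u1 v0 v1 w0 w1) (by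
    intro i
    fin_cases i
    · exact hrel.ab
    · rfl
    · show cpGen 2 * _ = _ * cpGen 2
      rw [h0, mul_zero, zero_mul]
    · exact hrel.de_be)
  rw [Subalgebra.mem_center_iff] at hm
  obtain ⟨r, hr⟩ := hc _ fun c => (hm c).symm
  have hb := hrel.bb
  rw [hr, ← map_mul, ← map_add] at hb
  exact hx r (by rw [pow_two]; exact (algebraMap K _).injective hb)

theorem del_ne (x y u0 u1 v0 v1 w0 w1 : K) (hx : ∀ r : K, r ^ 2 + r ≠ x)
    (hdiv : IsDivisionAlg (CrossedProd K x y u0 u1 v0 v1 w0 w1))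
    (hc : ∀ z : CrossedProd K x y u0 u1 v0 v1 w0 w1, (∀ c, z * c = c * z) → ∃ r : K, z = algebraMap K _ r) :
    (cpGen 3 : CrossedProd K x y u0 u1 v0 v1 w0 w1) ≠ 0 := by
  intro h0
  have := hdiv.1
  have hrel := cp_rel (k := K) (a := x) (b := y) (u0 := u0) (u1 := u1) (v0 := v0) (v1 := v1)
    (w0 := w0) (w1 := w1)
  have hm := cp_central (cpGen 0 : CrossedProd K x y u0 u1 v0 v1 w0 w1) (by
    intro i
    fin_cases i
    · rfl
    · exact hrel.ab.symm
    · exact hrel.la_al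
    · show cpGen 3 * _ = _ * cpGen 3
      rw [h0, mul_zero, zero_mul])
  rw [Subalgebra.mem_center_iff] at hm
  obtain ⟨r, hr⟩ := hc _ fun c => (hm c).symm
  have hb := hrel.aa
  rw [hr, ← map_mul, ← map_add] at hb
  exact hx r (by rw [pow_two]; exact (algebraMap K _).injective hb)

theorem n_anis (x a b : K) (hx : ∀ r : K, r ^ 2 + r ≠ x) (h : a ^ 2 + a * b + x * b ^ 2 = 0) :
    a = 0 ∧ b = 0 := by
  have h2K : (2 : K) = 0 := CharTwo.two_eq_zero
  by_cases hb : b = 0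
  · subst hb
    simpa using h
  · exfalso
    apply hx (a / b)
    field_simp
    linear_combination h - x * b ^ 2 * h2K

theorem pi_anis (x y u0 u1 g w0 w1 : K) (hx : ∀ r : K, r ^ 2 + r ≠ x) (hy : ∀ r : K, r ^ 2 + r ≠ y)
    (hnorm : (u0 ^ 2 + u0 * u1 + x * u1 ^ 2) * (g ^ 2 + g + y) =
      w0 ^ 2 + w0 * w1 + (x + y) * w1 ^ 2)
    (hdiv : IsDivisionAlg (CrossedProd K x y u0 u1 g 1 w0 w1))
    (hrank : Module.finrank K (CrossedProd K x y u0 u1 g 1 w0 w1) = 16)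
    (hexp : HasExpFour K (CrossedProd K x y u0 u1 g 1 w0 w1)) :
    u0 ^ 2 + u0 * u1 + x * u1 ^ 2 ≠ 0 ∧ g ^ 2 + g + y ≠ 0 ∧
      ∀ z, q4 x (g ^ 2 + g + y) z = 0 → z = 0 := by
  have h2K : (2 : K) = 0 := CharTwo.two_eq_zero
  have hnt := hdiv.1
  have hc := central_of_exp hexp.2
  have hla := lam_ne _ _ _ _ _ _ _ _ hy hdiv hc
  have hde := del_ne _ _ _ _ _ _ _ _ hx hdiv hc
  have hrel := cp_rel (k := K) (a := x) (b := y) (u0 := u0) (u1 := u1) (v0 := g) (v1 := 1)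
    (w0 := w0) (w1 := w1)
  have hfin : Module.Finite K (CrossedProd K x y u0 u1 g 1 w0 w1) :=
    Module.finite_of_finrank_pos (by rw [hrank]; norm_num)
  have hNu : u0 ^ 2 + u0 * u1 + x * u1 ^ 2 ≠ 0 := by
    intro h0
    obtain ⟨rfl, rfl⟩ := n_anis x u0 u1 hx h0
    have := hrel.ll
    simp only [map_zero, zero_mul, add_zero] at this
    exact ((hdiv.2 _ hla).mul (hdiv.2 _ hla)).ne_zero this
  have hNv : g ^ 2 + g + y ≠ 0 := fun h0 => hy g (by linear_combination h0 - y * h2K)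
  have key : ∀ a0 b0 a1 b1 : K, (w1 = 0 ∧ b0 = 0 ∧ a1 = 0 ∧ b1 = 0) ∨
      a0 ^ 2 + a0 * b0 + x * b0 ^ 2 = (w0 ^ 2 + w0 * w1 + (x + y) * w1 ^ 2) *
      (a1 ^ 2 + a1 * b1 + x * b1 ^ 2) →
      algebraMap K (CrossedProd K x y u0 u1 g 1 w0 w1) (a0 + a1 * (w0 + w1) + b1 * w1 * x) +
      algebraMap K _ (a1 * w1 + b0 + b1 * (w0 + w1) + b1 * w1) * cpGen 0 +
      algebraMap K _ (a1 * w1) * cpGen 1 + algebraMap K _ (b1 * w1) * (cpGen 0 * cpGen 1) = 0 := by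
    intro a0 b0 a1 b1 hN
    by_contra hq
    obtain ⟨de', hde'⟩ := ring_anti _ _ _ _ _ _ _ _ a0 b0 a1 b1 _ _ _ _ hrel hdiv hla hde hN hq
    obtain ⟨f, -⟩ := cp_lift hde'
    exact hexp.1 (div_split hdiv hc f)
  have hw1 : w1 ≠ 0 := by
    intro h0
    have := key 1 0 0 0 (Or.inl ⟨h0, rfl, rfl, rfl⟩)
    simp at this
  refine ⟨hNu, hNv, fun z hz => ?_⟩
  have hk := key (z 0 * u0 + x * z 1 * u1) (z 0 * u1 + z 1 * u0 + z 1 * u1) (z 2) (z 3) (Or.inr ?_)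
  · have hind := cp_indep x y u0 u1 g 1 w0 w1 (by simpa using hnorm) hNu (by simpa using hNv)
    have hind4 := hind.comp (fun i : Fin 4 => (i, (0 : Fin 4))) (fun i j h => (Prod.ext_iff.1 h).1)
    rw [Fintype.linearIndependent_iff] at hind4
    have h4 := hind4 ![z 0 * u0 + x * z 1 * u1 + z 2 * (w0 + w1) + z 3 * w1 * x,
      z 2 * w1 + (z 0 * u1 + z 1 * u0 + z 1 * u1) + z 3 * (w0 + w1) + z 3 * w1, z 2 * w1, z 3 * w1] (by
      rw [← hk]
      simp [Fin.sum_univ_four, cpMon, Algebra.smul_def])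
    have e0 := h4 0
    have e1 := h4 1
    have e2 := h4 2
    have e3 := h4 3
    simp [hw1] at e0 e1 e2 e3
    simp [e2, e3] at e0 e1
    have hp : z 0 ^ 2 + z 0 * z 1 + x * z 1 ^ 2 = 0 := by
      simpa [q4, e2, e3] using hz
    obtain ⟨f0, f1⟩ := n_anis x _ _ hx hp
    funext i; fin_cases i <;> assumption
  · rw [← hnorm]
    simp only [q4] at hz
    clear key hexp hrank hdiv hc hla hde hrel hnorm hfin hNu
    grind
end

section
variable {k : Type u} [Field k]

theorem q4_form (b c : k) : ∃ Q : QuadraticForm k (Fin 4 → k), ∀ v, Q v = q4 b c v := by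
  refine ⟨Matrix.toQuadraticMap' !![1, 1, 0, 0; 0, b, 0, 0; 0, 0, c, c; 0, 0, 0, c * b], fun v => ?_⟩
  refine (toQM_apply _ v).trans ?_
  simp [Fin.sum_univ_four, q4]
  ring

theorem qL_form (a b : k) : ∃ Q : QuadraticForm k (Fin 4 → k), ∀ v, Q v = qL a b v := by
  refine ⟨Matrix.toQuadraticMap' !![0, 0, 0, 1; 0, 1, 1, 1; 0, 0, 1, 1; 0, 0, 0, a + b], fun v => ?_⟩
  refine (toQM_apply _ v).trans ?_
  simp [Fin.sum_univ_four, qL]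
  ring

def tcoL (a u0 u1 g w0 w1 : k) {B : Type*} [AddCommGroup B] [Module k B] (m : Fin 4 × Fin 4 → B) :
    ((Fin 4 → k) × (Fin 4 → k) × (Fin 4 → k) × (Fin 4 → k)) →ₗ[k] B where
  toFun z := ∑ i, tco a u0 u1 g w0 w1 z.1 z.2.1 z.2.2.1 z.2.2.2 i • m i
  map_add' z z' := by
    rw [← Finset.sum_add_distrib]
    refine Finset.sum_congr rfl fun i _ => ?_
    rw [← add_smul]
    congr 1
    obtain ⟨i, j⟩ := i
    fin_cases i <;> fin_cases j <;> simp [tco] <;> ring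
  map_smul' r z := by
    rw [RingHom.id_apply, Finset.smul_sum]
    refine Finset.sum_congr rfl fun i _ => ?_
    rw [smul_smul]
    congr 1
    obtain ⟨i, j⟩ := i
    fin_cases i <;> fin_cases j <;> simp [tco] <;> ring

theorem tcoL_inj (a u0 u1 g w0 w1 : k) (hu1 : u1 ≠ 0) (hw1 : w1 ≠ 0) {B : Type*} [AddCommGroup B]
    [Module k B] (m : Fin 4 × Fin 4 → B) (hm : LinearIndependent k m) (z) (hz : tcoL a u0 u1 g w0 w1 m z = 0) :
    z = 0 := by
  obtain ⟨z0, z1, z2, z3⟩ := z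
  rw [Fintype.linearIndependent_iff] at hm
  have h := hm _ hz
  have hz0 : z0 = 0 := by funext i; exact h (i, 0)
  have hz1 : z1 = 0 := by
    have e0 := h (0, 1)
    have e1 := h (1, 1)
    have e2 := h (2, 1)
    have e3 := h (3, 1)
    simp [tco, hu1] at e0 e1 e2 e3
    simp [e1] at e0
    simp [e3] at e2
    funext i; fin_cases i <;> assumption
  have hz2 : z2 = 0 := by
    have e0 := h (0, 2)
    have e1 := h (1, 2)
    have e2 := h (2, 2)
    have e3 := h (3, 2)
    simp [tco] at e0 e1 e2 e3
    simp [e2] at e0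
    simp [e3] at e1
    funext i; fin_cases i <;> assumption
  have hz3 : z3 = 0 := by
    have e0 := h (0, 3)
    have e1 := h (1, 3)
    have e2 := h (2, 3)
    have e3 := h (3, 3)
    simp [tco, hw1] at e0 e1 e2 e3
    simp [e2, e3] at e0 e1
    funext i; fin_cases i <;> assumption
  rw [hz0, hz1, hz2, hz3]; rfl

theorem main_form [CharP k 2] (a b u0 u1 g w0 w1 s t : k) (hs : s ≠ 0) (ht : t ≠ 0)
    (hnorm : (u0 ^ 2 + u0 * u1 + a * u1 ^ 2) * (g ^ 2 + g + b) = w0 ^ 2 + w0 * w1 + (a + b) * w1 ^ 2)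
    (hu : u0 ^ 2 + u0 * u1 + a * u1 ^ 2 ≠ 0) (hv : g ^ 2 + g + b ≠ 0) (hu1 : u1 ≠ 0) (hw1 : w1 ≠ 0)
    (D : Type u) [Ring D] [Algebra k D] [Module.Finite k D]
    (e : D ≃ₐ[k] CrossedProd k a b (u0 * s) (u1 * s) (g * t) t (w0 * (s * t)) (w1 * (s * t)))
    (hrank : Module.finrank k D = 16) :
    ∃ φ : QuadraticForm k D, (∀ (q : D) (p : Polynomial k),
      p ^ 4 = (LinearMap.mulLeft k q).charpoly → φ q = p.coeff 2) ∧
      QE k φ (fun v : (Fin 4 → k) × (Fin 4 → k) × (Fin 4 → k) × (Fin 4 → k) =>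
        qL a b v.1 + (s * u1 * q4 b (u0 ^ 2 + u0 * u1 + a * u1 ^ 2) v.2.1 +
        (t * q4 a (g ^ 2 + g + b) v.2.2.1 +
          s * t * w1 * q4 a (w0 ^ 2 + w0 * w1 + (a + b) * w1 ^ 2) v.2.2.2))) := by
  have hfin : Module.Finite k
      (CrossedProd k a b (u0 * s) (u1 * s) (g * t) t (w0 * (s * t)) (w1 * (s * t))) :=
    Module.Finite.equiv e.toLinearEquiv
  have hr := hrank
  rw [e.toLinearEquiv.finrank_eq] at hr
  obtain ⟨hli, hcoef⟩ := cp_s2 a b u0 u1 g w0 w1 s t hs ht hnorm hu hv hr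
  generalize (cpMon (cpGen 0) (cpGen 1) (cpGen 2) (cpGen 3) :
      _ → CrossedProd k a b (u0 * s) (u1 * s) (g * t) t (w0 * (s * t)) (w1 * (s * t))) = m at hli hcoef
  have hinj := tcoL_inj a u0 u1 g w0 w1 hu1 hw1 m hli
  let T := LinearMap.linearEquivOfInjective (tcoL a u0 u1 g w0 w1 m)
    ((injective_iff_map_eq_zero _).2 hinj) (by rw [hr]; simp)
  let E : D ≃ₗ[k] _ := e.toLinearEquiv.trans T.symm
  obtain ⟨Q0, hQ0⟩ := qL_form a b
  obtain ⟨Q1, hQ1⟩ := q4_form b (u0 ^ 2 + u0 * u1 + a * u1 ^ 2)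
  obtain ⟨Q2, hQ2⟩ := q4_form a (g ^ 2 + g + b)
  obtain ⟨Q3, hQ3⟩ := q4_form a (w0 ^ 2 + w0 * w1 + (a + b) * w1 ^ 2)
  let Φ : QuadraticForm k ((Fin 4 → k) × (Fin 4 → k) × (Fin 4 → k) × (Fin 4 → k)) :=
    Q0.prod (((s * u1) • Q1).prod ((t • Q2).prod ((s * t * w1) • Q3)))
  have hΦ : ∀ v, Φ v = qL a b v.1 + (s * u1 * q4 b (u0 ^ 2 + u0 * u1 + a * u1 ^ 2) v.2.1 +
        (t * q4 a (g ^ 2 + g + b) v.2.2.1 +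
          s * t * w1 * q4 a (w0 ^ 2 + w0 * w1 + (a + b) * w1 ^ 2) v.2.2.2)) := by
    intro v
    simp only [Φ, QuadraticMap.prod_apply, QuadraticMap.smul_apply, smul_eq_mul, hQ0, hQ1, hQ2, hQ3]
  refine ⟨Φ.comp (E : D →ₗ[k] _), fun q p hp => ?_, E, fun v => ?_⟩
  · have hTE : ∑ i, tco a u0 u1 g w0 w1 (E q).1 (E q).2.1 (E q).2.2.1 (E q).2.2.2 i • m i = e q := by
      have : T (E q) = e q := by simp [E]
      rw [← this]; rfl
    have hc := hcoef (E q).1 (E q).2.1 (E q).2.2.1 (E q).2.2.2 p (by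
      rw [hTE, hp, ← LinearEquiv.charpoly_conj e.toLinearEquiv]
      congr 1
      ext z
      simp [LinearEquiv.conj_apply])
    rw [hc, QuadraticMap.comp_apply]
    refine (hΦ _).trans ?_
    show qL a b (E q).1 + _ = _
    simp only [add_assoc]
    rfl
  · rw [QuadraticMap.comp_apply]
    exact (hΦ _).symm
end

theorem QE.equivalent {k : Type*} [Field k] {V W : Type*} [AddCommGroup V] [Module k V] [AddCommGroup W]
    [Module k W] {f : QuadraticForm k V} {g : QuadraticForm k W} (h : QE k f g) :
    QuadraticMap.Equivalent f g := by
  obtain ⟨e, he⟩ := h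
  exact ⟨{ e with map_app' := he }⟩

def rearr1 (k : Type*) [Field k] (V W X Y Z : Type*) [AddCommGroup V] [Module k V] [AddCommGroup W] [Module k W]
    [AddCommGroup X] [Module k X] [AddCommGroup Y] [Module k Y] [AddCommGroup Z] [Module k Z] :
    ((V × W × X × Y) × Z) ≃ₗ[k] ((V × Z) × (W × X × Y)) where
  toFun v := ((v.1.1, v.2), v.1.2)
  invFun v := ((v.1.1, v.2), v.1.2)
  map_add' _ _ := rfl
  map_smul' _ _ := rfl
  left_inv _ := rfl
  right_inv _ := rfl

def rearr2 (k : Type*) [Field k] (V W X Y Z : Type*) [AddCommGroup V] [Module k V] [AddCommGroup W] [Module k W]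
    [AddCommGroup X] [Module k X] [AddCommGroup Y] [Module k Y] [AddCommGroup Z] [Module k Z] [Subsingleton Z] :
    ((V × W × X) × Y) ≃ₗ[k] ((V × W × (X × Y)) × Z) where
  toFun v := ((v.1.1, v.1.2.1, (v.1.2.2, v.2)), 0)
  invFun v := ((v.1.1, v.1.2.1, v.1.2.2.1), v.1.2.2.2)
  map_add' _ _ := by simp
  map_smul' _ _ := by simp
  left_inv _ := rfl
  right_inv v := Prod.ext rfl (Subsingleton.elim _ _)

section
variable {k : Type u} [Field k] [CharP k 2]

theorem scale_QE (x c Y N r : k) (ζ : Fin 4 → k) (hc : c ≠ 0) (hr : r ≠ 0) (hζ : r = q4 x c ζ)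
    (h : QE k (q4 Y N) (q4 x c)) (d : k) :
    QE k (fun v => d * r * q4 Y N v) (fun v => d * q4 x c v) := by
  have h1 : QE k (fun v => r * q4 x c v) (q4 x c) := by
    rw [hζ] at hr ⊢
    exact q4_I4 x c ζ hc hr
  have h2 := ((h.mul r).trans h1).mul d
  simpa only [mul_assoc] using h2

theorem witt_main (a b u0 u1 g w0 w1 s t : k)
    (hnorm : (u0 ^ 2 + u0 * u1 + a * u1 ^ 2) * (g ^ 2 + g + b) = w0 ^ 2 + w0 * w1 + (a + b) * w1 ^ 2)
    (hu : u0 ^ 2 + u0 * u1 + a * u1 ^ 2 ≠ 0) (hv : g ^ 2 + g + b ≠ 0) (hu1 : u1 ≠ 0) (hw1 : w1 ≠ 0)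
    (ζ ξ : Fin 4 → k) (hζ : u1 = q4 a (g ^ 2 + g + b) ζ) (hξ : w1 = q4 a (g ^ 2 + g + b) ξ)
    (D : Type u) [AddCommGroup D] [Module k D] (φ : QuadraticForm k D)
    (h : QE k φ (fun v : (Fin 4 → k) × (Fin 4 → k) × (Fin 4 → k) × (Fin 4 → k) =>
        qL a b v.1 + (s * u1 * q4 b (u0 ^ 2 + u0 * u1 + a * u1 ^ 2) v.2.1 +
        (t * q4 a (g ^ 2 + g + b) v.2.2.1 +
          s * t * w1 * q4 a (w0 ^ 2 + w0 * w1 + (a + b) * w1 ^ 2) v.2.2.2)))) :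
    WittEquiv φ ((formOneOne k).prod ((quadPfister (fun _ : Fin 1 => g ^ 2 + g + b) a).prod
      (quadPfister ![s, t, g ^ 2 + g + b] a))) := by
  refine ⟨3, 0, QE.equivalent ?_⟩
  have A1 := scale_QE a (g ^ 2 + g + b) _ _ u1 ζ hv hu1 hζ (chain_u a b u0 u1 g w0 w1 hu1 hu hv hnorm) s
  have A3 := scale_QE a (g ^ 2 + g + b) _ _ w1 ξ hv hw1 hξ (chain_w a b u0 u1 g w0 w1 hu hv hnorm) (s * t)
  have s1 := h.prod (QE.refl (hypForm k 3))
  have s3 := (qL_QE a b (g ^ 2 + g + b) hv).symm.prod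
    (A1.prod ((QE.refl (fun v => t * q4 a (g ^ 2 + g + b) v)).prod A3))
  have s5 := ((QE.refl (formOneOne k)).prod ((pf1_QE (g ^ 2 + g + b) a).symm.prod
    (pf3_QE s t (g ^ 2 + g + b) a).symm)).prod (QE.refl (hypForm k 0))
  refine (s1.trans (QE.trans ⟨rearr1 k _ _ _ _ _, ?_⟩ s3)).trans (QE.trans ⟨rearr2 k _ _ _ _ _, ?_⟩ s5)
  · intro v
    simp only [rearr1, LinearEquiv.coe_mk, LinearMap.coe_mk, AddHom.coe_mk]
    ring
  · intro v
    simp only [rearr2, LinearEquiv.coe_mk, LinearMap.coe_mk, AddHom.coe_mk, piSum, map_zero]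
    ring
end

theorem q4_mat {K : Type*} [Field K] (x c : K) (z : Fin 4 → K) :
    ∑ i, ∑ j, (![![1, 1, 0, 0], ![0, x, 0, 0], ![0, 0, c, c], ![0, 0, 0, c * x]] : Fin 4 → Fin 4 → K) i j
      * z i * z j = q4 x c z := by
  simp [Fin.sum_univ_four, q4]
  ring

theorem q4_mat' {K L : Type*} [Field K] [Field L] [Algebra K L] (x c : K) (z : Fin 4 → L) :
    ∑ i, ∑ j, algebraMap K L ((![![1, 1, 0, 0], ![0, x, 0, 0], ![0, 0, c, c], ![0, 0, 0, c * x]] :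
      Fin 4 → Fin 4 → K) i j) * z i * z j = q4 (algebraMap K L x) (algebraMap K L c) z := by
  simp [Fin.sum_univ_four, q4]
  ring

theorem q4_univ {F : Type*} [Field F] [IsAlgClosed F] {K : Type*} [Field K] [CharP K 2]
    [Algebra (MvPolynomial (Fin 2) F) K] [IsFractionRing (MvPolynomial (Fin 2) F) K]
    (x c r : K) (han : ∀ z, q4 x c z = 0 → z = 0) : ∃ ζ, r = q4 x c ζ := by
  have h2K : (2 : K) = 0 := CharTwo.two_eq_zero
  obtain ⟨p, hp, h⟩ := frac_isotropic (F := F) (![![1, 1, 0, 0, 0], ![0, x, 0, 0, 0], ![0, 0, c, c, 0],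
    ![0, 0, 0, c * x, 0], ![0, 0, 0, 0, r]] : Fin 5 → Fin 5 → K)
  have h' : q4 x c ![p 0, p 1, p 2, p 3] + r * p 4 ^ 2 = 0 := by
    rw [← h]
    simp [Fin.sum_univ_five, q4]
    ring
  have h4 : p 4 ≠ 0 := by
    intro h4
    rw [h4] at h'
    have := han _ (by simpa using h')
    apply hp
    have e0 := congrFun this 0
    have e1 := congrFun this 1
    have e2 := congrFun this 2
    have e3 := congrFun this 3
    funext i; fin_cases i <;> assumption
  refine ⟨![p 0 / p 4, p 1 / p 4, p 2 / p 4, p 3 / p 4], ?_⟩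
  simp [q4] at h' ⊢
  field_simp
  linear_combination h' - (p 0 ^ 2 + p 0 * p 1 + x * p 1 ^ 2 + c * (p 2 ^ 2 + p 2 * p 3 + x * p 3 ^ 2)) * h2K

theorem q4_map {K L : Type*} [Field K] [Field L] [Algebra K L] (x c : K) (z : Fin 4 → K) :
    algebraMap K L (q4 x c z) = q4 (algebraMap K L x) (algebraMap K L c) (fun i => algebraMap K L (z i)) := by
  simp [q4]

/-- With `D = (K_{x,y}(s,t), us, vt, wst)` division of degree `4` over
`K(s,t)` and `v = g + β` (`g ≠ 0`): the second trace form `φ_D(q) = s₂(q)` admits the Tignol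
decomposition `φ_D = [1,1] + ⟨⟨g² + g + y, x]] + ⟨⟨s, t, g² + g + y, x]]` in `W_q(K(s,t))`; in
particular the `4`-fold Pfister form in the decomposition is `φ_{4,D} = ⟨⟨s, t, g² + g + y, x]]`
and it is anisotropic over `F(x,y,s,t) = K(s,t)`. -/
theorem tignol_four_fold_pfister_of_crossedProd
    (F : Type u) [Field F] [IsAlgClosed F] [CharP F 2]
    (K : Type u) [Field K] [Algebra (MvPolynomial (Fin 2) F) K]
    [IsFractionRing (MvPolynomial (Fin 2) F) K]
    (x y : K) (hx : x = algebraMap (MvPolynomial (Fin 2) F) K (MvPolynomial.X 0))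
    (hy : y = algebraMap (MvPolynomial (Fin 2) F) K (MvPolynomial.X 1))
    -- the data of `A = (K_{x,y}, u, v, w)`, `u = u₀ + u₁α`, `v = g + β`, `w = w₀ + w₁(α+β)`
    (u0 u1 g w0 w1 : K) (hg : g ≠ 0)
    (hnorm : (u0 ^ 2 + u0 * u1 + x * u1 ^ 2) * (g ^ 2 + g + y) =
      w0 ^ 2 + w0 * w1 + (x + y) * w1 ^ 2)
    (hdiv : IsDivisionAlg (CrossedProd K x y u0 u1 g 1 w0 w1))
    (hrank : Module.finrank K (CrossedProd K x y u0 u1 g 1 w0 w1) = 16)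
    (hexp : HasExpFour K (CrossedProd K x y u0 u1 g 1 w0 w1))
    -- the field `K(s,t)`
    (K2 : Type u) [Field K2] [Algebra (MvPolynomial (Fin 2) K) K2]
    [IsFractionRing (MvPolynomial (Fin 2) K) K2] [Algebra K K2]
    [IsScalarTower K (MvPolynomial (Fin 2) K) K2]
    (s t : K2) (hs : s = algebraMap (MvPolynomial (Fin 2) K) K2 (MvPolynomial.X 0))
    (ht : t = algebraMap (MvPolynomial (Fin 2) K) K2 (MvPolynomial.X 1))
    -- `D = (K_{x,y}(s,t), us, vt, wst)`, a division algebra of degree `4` over `K(s,t)`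
    (D : Type u) [Ring D] [Algebra K2 D] [Module.Finite K2 D]
    (hDiso : Nonempty
      (D ≃ₐ[K2] CrossedProd K2 (algebraMap K K2 x) (algebraMap K K2 y)
        (algebraMap K K2 u0 * s) (algebraMap K K2 u1 * s)
        (algebraMap K K2 g * t) t
        (algebraMap K K2 w0 * (s * t)) (algebraMap K K2 w1 * (s * t))))
    (hDdiv : IsDivisionAlg D) (hDrank : Module.finrank K2 D = 16) :
    ∃ φD : QuadraticForm K2 D,
      -- `φ_D(q) = s₂(q)`, the second coefficient of the reduced characteristic polynomial:
      -- the unique monic `4`-th root of the characteristic polynomial of left multiplication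
      (∀ (q : D) (p : Polynomial K2), p.Monic →
        p ^ 4 = (LinearMap.mulLeft K2 q).charpoly → φD q = p.coeff 2) ∧
      -- Tignol's decomposition `φ_D = [1,1] + φ_{2,D} + φ_{4,D}` in `W_q(K(s,t))`,
      -- with `φ_{2,D} = ⟨⟨g² + g + y, x]]` and `φ_{4,D} = ⟨⟨s, t, g² + g + y, x]]`
      WittEquiv φD
        ((formOneOne K2).prod
          ((quadPfister (fun _ : Fin 1 => algebraMap K K2 (g ^ 2 + g + y))
              (algebraMap K K2 x)).prod
            (quadPfister (![s, t, algebraMap K K2 (g ^ 2 + g + y)])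
              (algebraMap K K2 x)))) ∧
      -- and `φ_{4,D} = ⟨⟨s, t, g² + g + y, x]]` is anisotropic over `F(x,y,s,t)`
      (quadPfister (![s, t, algebraMap K K2 (g ^ 2 + g + y)])
          (algebraMap K K2 x)).Anisotropic := by
  have hP1 : Function.Injective ((algebraMap (MvPolynomial (Fin 2) F) K).comp MvPolynomial.C) :=
    (IsFractionRing.injective (MvPolynomial (Fin 2) F) K).comp (MvPolynomial.C_injective _ _)
  have : CharP K 2 := charP_of_injective_ringHom hP1 2
  have : CharP K2 2 := charP_of_injective_algebraMap (algebraMap K K2).injective 2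
  have hX : ∀ i : Fin 2, algebraMap (MvPolynomial (Fin 2) K) K2 (MvPolynomial.X i) ≠ 0 := by
    intro i h0
    exact MvPolynomial.X_ne_zero i (IsFractionRing.injective (MvPolynomial (Fin 2) K) K2
      (by rw [h0, map_zero]))
  have hs0 : s ≠ 0 := hs ▸ hX 0
  have ht0 : t ≠ 0 := ht ▸ hX 1
  obtain ⟨hNu, hNv, han⟩ := pi_anis x y u0 u1 g w0 w1 (fun r => hx ▸ no_as 0 r) (fun r => hy ▸ no_as 1 r)
    hnorm hdiv hrank hexp
  have hu1 := u1_ne x y u0 u1 g w0 w1 hNv hNu hnorm han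
  have hw1 := w1_ne x y u0 u1 g w0 w1 hNv hNu hnorm han
  obtain ⟨ζ, hζ⟩ := q4_univ (F := F) x (g ^ 2 + g + y) u1 han
  obtain ⟨ξ, hξ⟩ := q4_univ (F := F) x (g ^ 2 + g + y) w1 han
  obtain ⟨e⟩ := hDiso
  have inj : ∀ r : K, r ≠ 0 → algebraMap K K2 r ≠ 0 := fun r hr => by simpa using hr
  have hc : algebraMap K K2 (g ^ 2 + g + y) =
      algebraMap K K2 g ^ 2 + algebraMap K K2 g + algebraMap K K2 y := by simp
  have hnorm' := congrArg (algebraMap K K2) hnorm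
  have hNu' := inj _ hNu
  have hNv' := inj _ hNv
  have hζ' := congrArg (algebraMap K K2) hζ
  have hξ' := congrArg (algebraMap K K2) hξ
  rw [q4_map, hc] at hζ' hξ'
  rw [hc] at hNv'
  simp only [map_add, map_mul, map_pow] at hnorm' hNu'
  obtain ⟨φ, h1, h2⟩ := main_form _ _ _ _ _ _ _ s t hs0 ht0 hnorm' hNu' hNv' (inj _ hu1) (inj _ hw1) D e hDrank
  refine ⟨φ, fun q p _ hp => h1 q p hp, ?_, ?_⟩
  · rw [hc]
    exact witt_main _ _ _ _ _ _ _ s t hnorm' hNu' hNv' (inj _ hu1) (inj _ hw1) _ _ hζ' hξ' D φ h2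
  · intro v hv
    rw [← pfL3_apply] at hv
    apply pfL3_inj
    generalize pfL3 K2 v = z at hv
    have := frac_anis _ (fun z hz => han z (by rwa [q4_mat] at hz)) s t hs ht
      (fun a => ![![z.1, z.2.2.1], ![z.2.1, z.2.2.2]] a.1 a.2) (by
        simp only [q4_mat']
        simp only [piSum, hc] at hv
        simp [Fintype.sum_prod_type, Fin.sum_univ_two]
        linear_combination hv)
    exact Prod.ext (congrFun this (0, 0)) (Prod.ext (congrFun this (1, 0))
      (Prod.ext (congrFun this (0, 1)) (congrFun this (1, 1))))

end
end
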